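/- arXiv:1405.7582 — 11 statements merged into one kernel-verified Lean document; each statement's English description precedes it below -/
import Mathlib

section
/- Let M be a conical refinement monoid. If a, b, c are elements of M with a + b = a + c and a is irreducible, then b = c. That is, irreducible elements cancel from sums in conical refinement monoids. -/
/-- A commutative monoid satisfies the Riesz refinement property if every equation
`x1 + x2 = y1 + y2` admits a refinement matrix. -/
def IsRefinementAddMonoid (M : Type*) [AddCommMonoid M] : Prop :=
  ∀ x1 x2 y1 y2 : M, x1 + x2 = y1 + y2 →
    ∃ z11 z12 z21 z22 : M,
      x1 = z11 + z12 ∧ x2 = z21 + z22 ∧ y1 = z11 + z21 ∧ y2 = z12 + z22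

/-- The algebraic (minimal) ordering on a commutative monoid: `x ≤ y` iff `x + z = y`
for some `z`. -/
def AlgLE {M : Type*} [AddCommMonoid M] (x y : M) : Prop := ∃ z, x + z = y

/-- A commutative monoid is conical if `x + y = 0` implies `x = y = 0`. -/
def IsConical (M : Type*) [AddCommMonoid M] : Prop :=
  ∀ x y : M, x + y = 0 → x = 0 ∧ y = 0

/-- Stably finite: `x + y = x` implies `y = 0`. -/
def IsStablyFinite (M : Type*) [AddCommMonoid M] : Prop :=
  ∀ x y : M, x + y = x → y = 0

/-- Separative: `2x = 2y = x + y` implies `x = y`. -/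
def IsSeparative (M : Type*) [AddCommMonoid M] : Prop :=
  ∀ x y : M, x + x = y + y → x + x = x + y → x = y

/-- Cancellative: `x + y = x + z` implies `y = z`. -/
def IsCancellative (M : Type*) [AddCommMonoid M] : Prop :=
  ∀ x y z : M, x + y = x + z → y = z

/-- Unperforated: `m x ≤ m y` implies `x ≤ y` (algebraic order), for positive `m`. -/
def IsUnperforated (M : Type*) [AddCommMonoid M] : Prop :=
  ∀ (m : ℕ) (x y : M), 0 < m → AlgLE (m • x) (m • y) → AlgLE x y

/-- Antisymmetric: the algebraic ordering is antisymmetric. -/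
def IsAntisymmetricMon (M : Type*) [AddCommMonoid M] : Prop :=
  ∀ x y : M, AlgLE x y → AlgLE y x → x = y

/-- Archimedean: if `n x ≤ y` for all positive `n`, then `x` is invertible. -/
def IsArchimedeanMon (M : Type*) [AddCommMonoid M] : Prop :=
  ∀ x y : M, (∀ n : ℕ, 0 < n → AlgLE (n • x) y) → IsAddUnit x

/-- Riesz interpolation property. -/
def HasRieszInterpolation (M : Type*) [AddCommMonoid M] : Prop :=
  ∀ x1 x2 y1 y2 : M, AlgLE x1 y1 → AlgLE x1 y2 → AlgLE x2 y1 → AlgLE x2 y2 →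
    ∃ z : M, AlgLE x1 z ∧ AlgLE x2 z ∧ AlgLE z y1 ∧ AlgLE z y2

/-- An element is irreducible if it is not invertible and whenever `x = a + b`,
either `a` or `b` is invertible. -/
def IsIrreducibleElem {M : Type*} [AddCommMonoid M] (x : M) : Prop :=
  ¬ IsAddUnit x ∧ ∀ a b : M, x = a + b → IsAddUnit a ∨ IsAddUnit b

/-- In a conical refinement monoid, irreducible elements cancel from sums. -/
theorem irreducible_cancels {M : Type*} [AddCommMonoid M]
    (href : IsRefinementAddMonoid M) (hcon : IsConical M)
    (a b c : M) (ha : IsIrreducibleElem a) (h : a + b = a + c) : b = c := by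
  have hu : ∀ x : M, IsAddUnit x → x = 0 := by
    intro x hx
    obtain ⟨y, hy⟩ := hx.exists_neg
    exact (hcon x y hy).1
  obtain ⟨p, q, r, s, h1, h2, h3, h4⟩ := href a b a c h
  rcases ha.2 p q h1 with hp | hq
  · have hp0 := hu p hp
    rw [hp0, zero_add] at h1 h3
    rw [h2, h4, ← h1, ← h3]
  · have hq0 := hu q hq
    rw [hq0, add_zero] at h1
    rcases ha.2 p r h3 with hp | hr
    · exact absurd (h1 ▸ hp) ha.1
    · rw [h2, h4, hu r hr, hq0]
end

section
/- Let (a_i)_{i∈I} be a family of distinct irreducible elements in a conical refinement monoid M. Then the submonoid J generated by the a_i (the set of all finite sums of the a_i with nonnegative integer coefficients) is an o-ideal of M, i.e., whenever x ∈ M and y ∈ J with x ≤ y in the algebraic ordering, it follows that x ∈ J. -/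
/-- The submonoid generated by a family of distinct irreducible elements in a conical
refinement monoid is an o-ideal: it is hereditary with respect to the algebraic order. -/
theorem closure_of_irreducibles_isOIdeal {M : Type*} [AddCommMonoid M]
    (href : IsRefinementAddMonoid M) (hcon : IsConical M)
    {I : Type*} (a : I → M) (hirr : ∀ i, IsIrreducibleElem (a i))
    (hinj : Function.Injective a) :
    ∀ x y : M, y ∈ AddSubmonoid.closure (Set.range a) → AlgLE x y →
      x ∈ AddSubmonoid.closure (Set.range a) := by
  have unit0 : ∀ u : M, IsAddUnit u → u = 0 := by
    intro u hu
    obtain ⟨v, hv⟩ := hu.exists_neg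
    exact (hcon u v hv).1
  intro x y hy
  induction hy using AddSubmonoid.closure_induction generalizing x with
  | mem y hy =>
    obtain ⟨i, rfl⟩ := hy
    rintro ⟨z, hz⟩
    rcases (hirr i).2 x z hz.symm with h | h
    · rw [unit0 x h]; exact zero_mem _
    · rw [unit0 z h, add_zero] at hz
      rw [hz]; exact AddSubmonoid.subset_closure ⟨i, rfl⟩
  | zero =>
    rintro ⟨z, hz⟩
    rw [(hcon x z hz).1]; exact zero_mem _
  | add p q _ _ ihp ihq =>
    rintro ⟨z, hz⟩
    obtain ⟨z11, z12, z21, z22, h1, h2, h3, h4⟩ := href x z p q hz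
    rw [h1]
    exact add_mem (ihp z11 ⟨z21, h3.symm⟩) (ihq z12 ⟨z22, h4.symm⟩)
end

section
/- Let a_1, ..., a_n be distinct irreducible elements in a conical refinement monoid M. If m_1 a_1 + ... + m_n a_n = m'_1 a_1 + ... + m'_n a_n for nonnegative integers m_i, m'_i, then m_i = m'_i for all i. Consequently, for a family (a_i)_{i∈I} of distinct irreducible elements, the map from the direct sum of copies of the nonnegative integers indexed by I to M sending (m_i) to Σ m_i a_i is an isomorphism onto the submonoid generated by the a_i. -/
lemma aux_zero {M : Type*} [AddCommMonoid M] (hcon : IsConical M) {x : M}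
    (h : IsAddUnit x) : x = 0 := by
  obtain ⟨y, hy⟩ := h.exists_neg
  exact (hcon _ _ hy).1

lemma aux_irr {M : Type*} [AddCommMonoid M] (hcon : IsConical M) {x : M}
    (h : IsIrreducibleElem x) : x ≠ 0 ∧ ∀ b c : M, x = b + c → b = 0 ∨ c = 0 := by
  refine ⟨?_, fun b c hbc => (h.2 b c hbc).imp (aux_zero hcon) (aux_zero hcon)⟩
  rintro rfl
  exact h.1 isAddUnit_zero

lemma aux_cancel {M : Type*} [AddCommMonoid M] (href : IsRefinementAddMonoid M)
    (hcon : IsConical M) {a x y : M} (ha : IsIrreducibleElem a) (h : a + x = a + y) :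
    x = y := by
  obtain ⟨h0, hi⟩ := aux_irr hcon ha
  obtain ⟨z11, z12, z21, z22, h1, h2, h3, h4⟩ := href _ _ _ _ h
  rcases hi _ _ h1 with e | e
  · subst e
    rw [zero_add] at h1 h3
    rw [h2, h4, ← h1, ← h3]
  · subst e
    rw [add_zero] at h1
    subst h1
    rcases hi _ _ h3 with e | e
    · exact absurd e h0
    · rw [h2, h4, e]

lemma aux_mem {M : Type*} [AddCommMonoid M] (href : IsRefinementAddMonoid M)
    (hcon : IsConical M) {a : M} (ha : IsIrreducibleElem a) (t : Multiset M) :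
    (∀ b ∈ t, IsIrreducibleElem b) → ∀ x, a + x = t.sum → a ∈ t := by
  obtain ⟨h0, hi⟩ := aux_irr hcon ha
  induction t using Multiset.induction_on with
  | empty =>
    intro _ x hx
    exact absurd (hcon _ _ (by simpa using hx)).1 h0
  | cons b t ih =>
    intro ht x hx
    rw [Multiset.sum_cons] at hx
    obtain ⟨hb0, hbi⟩ := aux_irr hcon (ht b (Multiset.mem_cons_self b t))
    obtain ⟨z11, z12, z21, z22, h1, h2, h3, h4⟩ := href _ _ _ _ hx
    rcases hi _ _ h1 with e | e
    · rw [e, zero_add] at h1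
      rw [← h1] at h4
      exact Multiset.mem_cons_of_mem
        (ih (fun c hc => ht c (Multiset.mem_cons_of_mem hc)) z22 h4.symm)
    · rw [e, add_zero] at h1
      rw [← h1] at h3
      rcases hbi _ _ h3 with e' | e'
      · exact absurd e' h0
      · rw [e', add_zero] at h3
        rw [h3]
        exact Multiset.mem_cons_self _ _

lemma aux_inj {M : Type*} [AddCommMonoid M] (href : IsRefinementAddMonoid M)
    (hcon : IsConical M) (s : Multiset M) : ∀ t : Multiset M,
    (∀ b ∈ s, IsIrreducibleElem b) → (∀ b ∈ t, IsIrreducibleElem b) →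
    s.sum = t.sum → s = t := by
  induction s using Multiset.induction_on with
  | empty =>
    intro t _ ht h
    rcases t.empty_or_exists_mem with e | ⟨b, hb⟩
    · exact e.symm
    · obtain ⟨u, rfl⟩ := Multiset.exists_cons_of_mem hb
      rw [Multiset.sum_zero, Multiset.sum_cons] at h
      exact absurd (hcon _ _ h.symm).1 (aux_irr hcon (ht b hb)).1
  | cons a s ih =>
    intro t hs ht h
    have ha := hs a (Multiset.mem_cons_self a s)
    rw [Multiset.sum_cons] at h
    obtain ⟨u, rfl⟩ := Multiset.exists_cons_of_mem (aux_mem href hcon ha t ht _ h)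
    rw [Multiset.sum_cons] at h
    rw [ih u (fun c hc => hs c (Multiset.mem_cons_of_mem hc))
      (fun c hc => ht c (Multiset.mem_cons_of_mem hc)) (aux_cancel href hcon ha h)]

lemma aux_sum {M I : Type*} [AddCommMonoid M] (a : I → M) (f : I →₀ ℕ) :
    (f.sum fun i k => k • a i) = ((Finsupp.toMultiset f).map a).sum := by
  rw [Finsupp.toMultiset_apply, Finsupp.sum, Finsupp.sum,
    ← Multiset.coe_mapAddMonoidHom, map_sum, ← Multiset.coe_sumAddMonoidHom, map_sum]
  simp [Multiset.map_nsmul, Multiset.sum_nsmul]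

lemma aux_finsupp {M I : Type*} [AddCommMonoid M] (href : IsRefinementAddMonoid M)
    (hcon : IsConical M) (a : I → M) (ha : ∀ i, IsIrreducibleElem (a i))
    (hinj : Function.Injective a) :
    Function.Injective (fun f : I →₀ ℕ => f.sum fun i k => k • a i) := by
  intro f g h
  simp only [aux_sum] at h
  have := aux_inj href hcon _ _ (by simp only [Multiset.mem_map]; rintro b ⟨i, -, rfl⟩; exact ha i)
    (by simp only [Multiset.mem_map]; rintro b ⟨i, -, rfl⟩; exact ha i) h
  classical
  exact (Multiset.toFinsupp (α := I)).symm.injective (Multiset.map_injective hinj this)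

/-- Distinct irreducible elements of a conical refinement monoid are linearly independent
over `ℕ`, and the induced map from the direct sum of copies of `ℕ` is an isomorphism
(an injective homomorphism) onto the submonoid they generate. -/
theorem irreducibles_freely_generate {M : Type*} [AddCommMonoid M]
    (href : IsRefinementAddMonoid M) (hcon : IsConical M) :
    (∀ (n : ℕ) (a : Fin n → M), (∀ i, IsIrreducibleElem (a i)) → Function.Injective a →
      ∀ m m' : Fin n → ℕ, ∑ i, m i • a i = ∑ i, m' i • a i → m = m') ∧
    (∀ (I : Type) (a : I → M), (∀ i, IsIrreducibleElem (a i)) → Function.Injective a →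
      Function.Injective (fun f : I →₀ ℕ => f.sum fun i k => k • a i) ∧
      (∀ f g : I →₀ ℕ, ((f + g).sum fun i k => k • a i)
          = (f.sum fun i k => k • a i) + (g.sum fun i k => k • a i)) ∧
      Set.range (fun f : I →₀ ℕ => f.sum fun i k => k • a i)
        = (AddSubmonoid.closure (Set.range a) : Set M)) := by
  constructor
  · intro n a ha hinj m m' h
    have := @aux_finsupp M (Fin n) _ href hcon a ha hinj
      (Finsupp.equivFunOnFinite.symm m) (Finsupp.equivFunOnFinite.symm m')
      (by simpa [Finsupp.sum_fintype] using h)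
    exact Finsupp.equivFunOnFinite.symm.injective this
  · intro I a ha hinj
    have hadd : ∀ f g : I →₀ ℕ, ((f + g).sum fun i k => k • a i)
          = (f.sum fun i k => k • a i) + (g.sum fun i k => k • a i) := by
      intro f g
      simp only [aux_sum, map_add, Multiset.map_add, Multiset.sum_add]
    refine ⟨aux_finsupp href hcon a ha hinj, hadd, ?_⟩
    ext x
    constructor
    · rintro ⟨f, rfl⟩
      exact AddSubmonoid.sum_mem _ fun i _ =>
        AddSubmonoid.nsmul_mem _ (AddSubmonoid.subset_closure (Set.mem_range_self i)) _
    · intro hx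
      induction hx using AddSubmonoid.closure_induction with
      | mem x hx =>
        obtain ⟨i, rfl⟩ := hx
        exact ⟨Finsupp.single i 1, by simp⟩
      | zero => exact ⟨0, by simp⟩
      | add x y _ _ hx hy =>
        obtain ⟨f, rfl⟩ := hx
        obtain ⟨g, rfl⟩ := hy
        exact ⟨f + g, hadd f g⟩
end

section
/- Every tame refinement monoid M is separative, unperforated, and satisfies the Riesz interpolation property. -/
/-- A witness that the inclusion of the submonoid `S` into `M` factors through a
finitely generated refinement monoid. -/
structure TameWitness (M : Type*) [AddCommMonoid M] (S : AddSubmonoid M) where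
  N : Type
  [instN : AddCommMonoid N]
  fg : AddMonoid.FG N
  refinement : IsRefinementAddMonoid N
  f : ↥S →+ N
  g : N →+ M
  factors : ∀ s : ↥S, g (f s) = (s : M)

/-- A (refinement) monoid is tame if for each finitely generated submonoid `S ⊆ M`, the
inclusion map `S → M` factors through a finitely generated refinement monoid. -/
def IsTame (M : Type*) [AddCommMonoid M] : Prop :=
  ∀ S : AddSubmonoid M, S.FG → Nonempty (TameWitness M S)


namespace TameAux

variable {N : Type*} [AddCommMonoid N]

lemma le_rfl' (x : N) : AlgLE x x := ⟨0, add_zero x⟩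
lemma le_tr {x y z : N} (h : AlgLE x y) (h' : AlgLE y z) : AlgLE x z := by
  obtain ⟨a, rfl⟩ := h
  obtain ⟨b, rfl⟩ := h'
  exact ⟨a + b, by abel⟩
lemma le_add {x y z w : N} (h : AlgLE x y) (h' : AlgLE z w) : AlgLE (x + z) (y + w) := by
  obtain ⟨a, rfl⟩ := h
  obtain ⟨b, rfl⟩ := h'
  exact ⟨a + b, by abel⟩
lemma le_left (x y : N) : AlgLE x (x + y) := ⟨y, rfl⟩
lemma le_right (x y : N) : AlgLE y (x + y) := ⟨x, add_comm _ _⟩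
lemma zero_le' (x : N) : AlgLE 0 x := ⟨x, zero_add x⟩
lemma le_nsmul {x y : N} (n : ℕ) (h : AlgLE x y) : AlgLE (n • x) (n • y) := by
  obtain ⟨a, rfl⟩ := h
  exact ⟨n • a, by rw [nsmul_add]⟩
lemma nsmul_le {m n : ℕ} (h : m ≤ n) (x : N) : AlgLE (m • x) (n • x) := by
  obtain ⟨k, rfl⟩ := Nat.exists_eq_add_of_le h
  exact ⟨k • x, by rw [add_nsmul]⟩

/-- weak primes -/
def Pr (p : N) : Prop := ∀ a b : N, AlgLE p (a + b) → AlgLE p a ∨ AlgLE p b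

lemma decomp (hr : IsRefinementAddMonoid N) {x a b : N} (h : AlgLE x (a + b)) :
    ∃ a' b', x = a' + b' ∧ AlgLE a' a ∧ AlgLE b' b := by
  obtain ⟨c, hc⟩ := h
  obtain ⟨z11, z12, z21, z22, h1, h2, h3, h4⟩ := hr _ _ _ _ hc
  exact ⟨z11, z12, h1, ⟨z21, h3.symm⟩, ⟨z22, h4.symm⟩⟩

lemma Pr.split (hr : IsRefinementAddMonoid N) {p : N} (hp : Pr p) (n : ℕ) :
    ∀ a b : N, AlgLE (n • p) (a + b) → ∃ i j, i + j = n ∧ AlgLE (i • p) a ∧ AlgLE (j • p) b := by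
  induction n with
  | zero => intro a b _; exact ⟨0, 0, rfl, by simpa using zero_le' a, by simpa using zero_le' b⟩
  | succ n ih =>
    intro a b h
    obtain ⟨c, hc⟩ := h
    rw [succ_nsmul, add_assoc] at hc
    -- n p + (p + c) = a + b
    obtain ⟨z11, z12, z21, z22, h1, h2, h3, h4⟩ := hr _ _ _ _ hc
    obtain ⟨i, j, hij, hi, hj⟩ := ih z11 z12 ⟨0, by rw [add_zero, h1]⟩
    rcases hp z21 z22 (h2 ▸ le_left p c) with h | h
    · refine ⟨i + 1, j, by omega, ?_, ?_⟩
      · rw [succ_nsmul, h3]; exact le_add hi h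
      · rw [h4]; exact le_tr hj (le_left _ _)
    · refine ⟨i, j + 1, by omega, ?_, ?_⟩
      · rw [h3]; exact le_tr hi (le_left _ _)
      · rw [succ_nsmul, h4]; exact le_add hj h

lemma Pr.unperf (hr : IsRefinementAddMonoid N) {p : N} (hp : Pr p) (n : ℕ) (b : N) (m : ℕ) :
    AlgLE (((m + 1) * n) • p) ((m + 1) • b) → AlgLE (n • p) b := by
  induction m with
  | zero => intro h; simpa using h
  | succ m ih =>
    intro h
    rw [succ_nsmul _ (m + 1)] at h
    obtain ⟨i, j, hij, hi, hj⟩ := hp.split hr _ _ _ h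
    by_cases hjn : n ≤ j
    · exact le_tr (nsmul_le hjn p) hj
    · refine ih (le_tr (nsmul_le ?_ p) hi)
      have : (m + 1 + 1) * n = (m + 1) * n + n := by ring
      omega

/-- canonical representatives -/
lemma exists_rep (N : Type*) [AddCommMonoid N] : ∃ r : N → N, (∀ x, AlgLE (r x) x ∧ AlgLE x (r x)) ∧
    ∀ x y, AlgLE x y → AlgLE y x → r x = r y := by
  let s : Setoid N := ⟨fun x y => AlgLE x y ∧ AlgLE y x,
    ⟨fun x => ⟨le_rfl' x, le_rfl' x⟩, fun h => ⟨h.2, h.1⟩,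
      fun h h' => ⟨le_tr h.1 h'.1, le_tr h'.2 h.2⟩⟩⟩
  refine ⟨fun x => (Quotient.mk s x).out, fun x => ?_, fun x y h h' => ?_⟩
  · exact Quotient.exact (s := s) (Quotient.out_eq (Quotient.mk s x))
  · have : Quotient.mk s x = Quotient.mk s y := Quotient.sound (s := s) ⟨h, h'⟩
    simp only [this]

open Classical in
lemma key (hr : IsRefinementAddMonoid N) (r : N → N)
    (hr2 : ∀ x y, AlgLE x y → AlgLE y x → r x = r y) (n : ℕ) :
    ∀ (L : Multiset N) (b : N), L.card = n → (∀ q ∈ L, Pr q ∧ r q = q) →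
      (∀ q, AlgLE (L.count q • q) b) → AlgLE L.sum b := by
  induction n with
  | zero =>
    intro L b hL _ _
    rw [Multiset.card_eq_zero] at hL
    subst hL
    exact zero_le' b
  | succ n ih =>
    intro L b hL hP hc
    by_cases hred : ∃ q p L', L = q ::ₘ p ::ₘ L' ∧ AlgLE (q + p) p
    · obtain ⟨q, p, L', rfl, hqp⟩ := hred
      have h1 : AlgLE (p ::ₘ L').sum b := by
        apply ih _ b (by simpa using hL) (fun t ht => hP t (Multiset.mem_cons_of_mem ht))
        intro t
        exact le_tr (nsmul_le (Multiset.count_le_count_cons _ _ _) t) (hc t)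
      refine le_tr ?_ h1
      simp only [Multiset.sum_cons, ← add_assoc]
      exact le_add hqp (le_rfl' _)
    · have hpos : 0 < L.card := by omega
      obtain ⟨p, hpL⟩ := Multiset.card_pos_iff_exists_mem.1 hpos
      obtain ⟨L', rfl⟩ := Multiset.exists_cons_of_mem hpL
      have hpp := hP p (Multiset.mem_cons_self _ _)
      have hpb : AlgLE p b := by
        have := hc p
        rw [Multiset.count_cons_self] at this
        refine le_tr ?_ this
        simpa using nsmul_le (show 1 ≤ L'.count p + 1 by omega) p
      obtain ⟨c, rfl⟩ := hpb
      rw [Multiset.sum_cons]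
      refine le_add (le_rfl' p) ?_
      apply ih L' c (by simpa using hL) (fun t ht => hP t (Multiset.mem_cons_of_mem ht))
      intro q
      by_cases hq : q ∈ L'
      swap
      · rw [Multiset.count_eq_zero_of_notMem hq, zero_nsmul]; exact zero_le' c
      have hpq := hP q (Multiset.mem_cons_of_mem hq)
      have hn : ¬ AlgLE (q + p) p := by
        intro h
        obtain ⟨L'', rfl⟩ := Multiset.exists_cons_of_mem hq
        exact hred ⟨q, p, L'', Multiset.cons_swap _ _ _, h⟩
      obtain ⟨i, j, hij, hi, hj⟩ := hpq.1.split hr _ _ _ (hc q)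
      refine le_tr (nsmul_le ?_ q) hj
      have hi1 : i ≤ 1 := by
        by_contra h
        have h2 : AlgLE (2 • q) p := le_tr (nsmul_le (by omega) q) hi
        apply hn
        obtain ⟨d, hd⟩ := h2
        rw [two_nsmul, add_assoc] at hd
        rcases hpp.1 q (q + d) (hd ▸ le_rfl' _) with h | h
        · refine le_tr (le_add (le_rfl' q) h) ⟨d, ?_⟩
          rw [add_assoc, hd]
        · refine le_tr (le_add (le_rfl' q) h) ⟨0, ?_⟩
          rw [add_zero, hd]
      by_cases hqp : q = p
      · subst hqp
        rw [Multiset.count_cons_self] at hij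
        omega
      · rw [Multiset.count_cons_of_ne hqp] at hij
        have : i = 0 := by
          by_contra h
          have hqp' : AlgLE q p := by
            refine le_tr ?_ hi
            simpa using nsmul_le (show 1 ≤ i by omega) q
          obtain ⟨d, hd⟩ := hqp'
          rcases hpp.1 q d (hd ▸ le_rfl' _) with h | h
          · apply hqp
            rw [← hpq.2, ← hpp.2]
            exact hr2 _ _ ⟨d, hd⟩ h
          · apply hn
            refine le_tr (le_add (le_rfl' q) h) ⟨0, ?_⟩
            rw [add_zero, hd]
        omega

lemma wf_of_fg (hfg : AddMonoid.FG N) :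
    WellFounded (fun x y : N => AlgLE x y ∧ ¬ AlgLE y x) := by
  have : Module.Finite ℕ N := Module.Finite.iff_addMonoid_fg.2 hfg
  obtain ⟨n, f, hf⟩ := Module.Finite.exists_fin' ℕ N
  rw [wellFounded_iff_isEmpty_descending_chain]
  refine ⟨fun ⟨u, hu⟩ => ?_⟩
  choose v hv using fun k => hf (u k)
  have hmono : ∀ i k, AlgLE (u (i + k)) (u i) := by
    intro i k
    induction k with
    | zero => exact le_rfl' _
    | succ k ih => exact le_tr (hu (i + k)).1 ih
  have hw : WellQuasiOrdered (fun a b : Fin n → ℕ => a ≤ b) := wellQuasiOrdered_le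
  obtain ⟨i, j, hij, h⟩ := hw v
  obtain ⟨k, rfl⟩ := Nat.exists_eq_add_of_le (Nat.succ_le_of_lt hij)
  obtain ⟨d, hd⟩ := exists_add_of_le h
  apply (hu i).2
  refine le_tr ?_ (hmono (i + 1) k)
  refine ⟨f d, ?_⟩
  rw [← hv, ← hv, ← map_add, hd]

lemma primely (hr : IsRefinementAddMonoid N) (hfg : AddMonoid.FG N) (x : N) :
    ∃ L : Multiset N, (∀ q ∈ L, Pr q) ∧ L.sum = x := by
  induction x using (wf_of_fg hfg).induction with
  | _ x ih =>
    by_cases hx : Pr x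
    · exact ⟨{x}, by simpa using hx, by simp⟩
    · unfold Pr at hx
      push Not at hx
      obtain ⟨a, b, hab, ha, hb⟩ := hx
      obtain ⟨a', b', rfl, ha', hb'⟩ := decomp hr hab
      obtain ⟨L1, h1, h1'⟩ := ih a' ⟨le_left _ _, fun h => ha (le_tr h ha')⟩
      obtain ⟨L2, h2, h2'⟩ := ih b' ⟨le_right _ _, fun h => hb (le_tr h hb')⟩
      refine ⟨L1 + L2, ?_, by simp [h1', h2']⟩
      intro q hq
      rcases Multiset.mem_add.1 hq with h | h
      · exact h1 q h
      · exact h2 q h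

lemma primely' (hr : IsRefinementAddMonoid N) (hfg : AddMonoid.FG N) (r : N → N)
    (hr1 : ∀ x, AlgLE (r x) x ∧ AlgLE x (r x))
    (hr2 : ∀ x y, AlgLE x y → AlgLE y x → r x = r y) (x : N) :
    ∃ L : Multiset N, (∀ q ∈ L, Pr q ∧ r q = q) ∧ AlgLE L.sum x ∧ AlgLE x L.sum := by
  obtain ⟨L, hL, rfl⟩ := primely hr hfg x
  refine ⟨L.map r, ?_, ?_⟩
  · intro q hq
    obtain ⟨p, hp, rfl⟩ := Multiset.mem_map.1 hq
    refine ⟨fun a b h => ?_, hr2 _ _ (hr1 p).1 (hr1 p).2⟩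
    exact (hL p hp a b (le_tr (hr1 p).2 h)).imp (le_tr (hr1 p).1) (le_tr (hr1 p).1)
  · clear hL
    induction L using Multiset.induction with
    | empty => simpa using le_rfl' (0 : N)
    | cons a s ih =>
      simp only [Multiset.map_cons, Multiset.sum_cons]
      exact ⟨le_add (hr1 a).1 ih.1, le_add (hr1 a).2 ih.2⟩

open Classical in
lemma count_le (L : Multiset N) (q : N) : AlgLE (L.count q • q) L.sum := by
  obtain ⟨T, hT⟩ := Multiset.le_iff_exists_add.1 (Multiset.le_count_iff_replicate_le.1 (le_refl (L.count q)))
  refine ⟨T.sum, ?_⟩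
  conv_rhs => rw [hT]
  simp

lemma sum_le {L L' : Multiset N} (h : L ≤ L') : AlgLE L.sum L'.sum := by
  obtain ⟨T, rfl⟩ := Multiset.le_iff_exists_add.1 h
  exact ⟨T.sum, by simp⟩

lemma fg_unperf (hr : IsRefinementAddMonoid N) (hfg : AddMonoid.FG N) : IsUnperforated N := by
  classical
  intro m x y hm h
  obtain ⟨k, rfl⟩ := Nat.exists_eq_succ_of_ne_zero hm.ne'
  obtain ⟨r, hr1, hr2⟩ := exists_rep N
  obtain ⟨L, hL, h1, h2⟩ := primely' hr hfg r hr1 hr2 x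
  refine le_tr h2 (key hr r hr2 _ L y rfl hL fun q => ?_)
  by_cases hq : q ∈ L
  · apply (hL q hq).1.unperf hr _ _ k
    refine le_tr ?_ h
    rw [mul_nsmul']
    exact le_nsmul _ (le_tr (count_le L q) h1)
  · rw [Multiset.count_eq_zero_of_notMem hq, zero_nsmul]; exact zero_le' y

lemma fg_interp (hr : IsRefinementAddMonoid N) (hfg : AddMonoid.FG N) :
    HasRieszInterpolation N := by
  classical
  intro x1 x2 y1 y2 h11 h12 h21 h22
  obtain ⟨r, hr1, hr2⟩ := exists_rep N
  obtain ⟨L1, hL1, h1, h1'⟩ := primely' hr hfg r hr1 hr2 x1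
  obtain ⟨L2, hL2, h2, h2'⟩ := primely' hr hfg r hr1 hr2 x2
  have main : ∀ y, AlgLE x1 y → AlgLE x2 y → AlgLE (L1 ∪ L2).sum y := by
    intro y hy1 hy2
    refine key hr r hr2 _ _ y rfl ?_ ?_
    · intro q hq
      exact (Multiset.mem_union.1 hq).elim (hL1 q) (hL2 q)
    · intro q
      rw [Multiset.count_union]
      rcases max_choice (L1.count q) (L2.count q) with h | h <;> rw [h]
      · exact le_tr (count_le _ _) (le_tr h1 hy1)
      · exact le_tr (count_le _ _) (le_tr h2 hy2)
  exact ⟨(L1 ∪ L2).sum, le_tr h1' (sum_le Multiset.le_union_left),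
    le_tr h2' (sum_le Multiset.le_union_right), main y1 h11 h21, main y2 h12 h22⟩

lemma Pr.cancel (hr : IsRefinementAddMonoid N) {p a b : N} (hp : Pr p) (h : p + a = p + b)
    (ha : AlgLE p a) (hb : AlgLE p b) : a = b := by
  by_cases hreg : AlgLE (p + p) p
  · obtain ⟨s, rfl⟩ := ha
    obtain ⟨t, rfl⟩ := hb
    obtain ⟨d, hd⟩ := hreg
    calc p + s = (p + p + d) + s := by rw [hd]
      _ = (p + (p + s)) + d := by abel
      _ = (p + (p + t)) + d := by rw [h]
      _ = (p + p + d) + t := by abel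
      _ = p + t := by rw [hd]
  · obtain ⟨z11, z12, z21, z22, h1, h2, h3, h4⟩ := hr _ _ _ _ h
    have aux : ∀ w u v : N, p = p + w + u → p = p + w + v → p + u = p + v := by
      intro w u v hu hv
      calc p + u = (p + w + v) + u := by rw [← hv]
        _ = (p + w + u) + v := by abel
        _ = p + v := by rw [← hu]
    by_cases h11 : AlgLE p z11
    · obtain ⟨w, rfl⟩ := h11
      have e := aux w z12 z21 h1 h3
      rcases hp z21 z22 (h2 ▸ ha) with h | h
      · exfalso
        apply hreg
        have h5 := le_add (le_left p w) h
        rwa [← h3] at h5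
      · obtain ⟨v, rfl⟩ := h
        calc a = (p + z21) + v := by rw [h2]; abel
          _ = (p + z12) + v := by rw [e]
          _ = b := by rw [h4]; abel
    · obtain ⟨w, rfl⟩ := (hp z11 z12 (h1 ▸ le_rfl' _)).resolve_left h11
      obtain ⟨w', rfl⟩ := (hp z11 z21 (h3 ▸ le_rfl' _)).resolve_left h11
      have e := aux z11 w w' (h1.trans (by abel)) (h3.trans (by abel))
      rw [h2, h4, e]

lemma fg_sep (hr : IsRefinementAddMonoid N) (hfg : AddMonoid.FG N) : IsSeparative N := by
  intro x y h1 h2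
  obtain ⟨L, hL, hx⟩ := primely hr hfg x
  have hle : ∀ q ∈ L, Pr q ∧ AlgLE q x ∧ AlgLE q y := by
    intro q hq
    have hqx : AlgLE q x := by
      obtain ⟨T, rfl⟩ := Multiset.exists_cons_of_mem hq
      rw [← hx, Multiset.sum_cons]; exact le_left _ _
    refine ⟨hL q hq, hqx, ?_⟩
    exact (hL q hq y y (h1 ▸ le_tr hqx (le_left _ _))).elim id id
  have h3 : L.sum + x = L.sum + y := by rw [hx, h2]
  clear hL hx h1 h2
  induction L using Multiset.induction with
  | empty => simpa using h3
  | cons p T ih =>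
    apply ih fun q hq => hle q (Multiset.mem_cons_of_mem hq)
    obtain ⟨hp, hpx, hpy⟩ := hle p (Multiset.mem_cons_self _ _)
    rw [Multiset.sum_cons, add_assoc, add_assoc] at h3
    exact hp.cancel hr h3 (le_tr hpx (le_right _ _)) (le_tr hpy (le_right _ _))

lemma le_map {P Q : Type*} [AddCommMonoid P] [AddCommMonoid Q] (g : P →+ Q) {x y : P}
    (h : AlgLE x y) : AlgLE (g x) (g y) := by
  obtain ⟨z, rfl⟩ := h
  exact ⟨g z, by rw [map_add]⟩

end TameAux

/-- Every tame refinement monoid is separative, unperforated, and satisfies the Riesz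
interpolation property. -/
theorem tame_separative_unperforated_interpolation
    (M : Type*) [AddCommMonoid M] (href : IsRefinementAddMonoid M) (htame : IsTame M) :
    IsSeparative M ∧ IsUnperforated M ∧ HasRieszInterpolation M := by
  classical
  have fgs : ∀ F : Finset M, (AddSubmonoid.closure (F : Set M)).FG := fun F => ⟨F, rfl⟩
  refine ⟨?_, ?_, ?_⟩
  · intro x y h1 h2
    let F : Finset M := {x, y}
    obtain ⟨W⟩ := htame _ (fgs F)
    letI := W.instN
    let X : AddSubmonoid.closure (F : Set M) := ⟨x, AddSubmonoid.subset_closure (by simp [F])⟩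
    let Y : AddSubmonoid.closure (F : Set M) := ⟨y, AddSubmonoid.subset_closure (by simp [F])⟩
    have e1 : X + X = Y + Y := Subtype.ext h1
    have e2 : X + X = X + Y := Subtype.ext h2
    have := TameAux.fg_sep W.refinement W.fg (W.f X) (W.f Y)
      (by rw [← map_add, ← map_add, e1]) (by rw [← map_add, ← map_add, e2])
    have h := congrArg W.g this
    rwa [W.factors, W.factors] at h
  · intro m x y hm ⟨z, hz⟩
    let F : Finset M := {x, y, z}
    obtain ⟨W⟩ := htame _ (fgs F)
    letI := W.instN
    let X : AddSubmonoid.closure (F : Set M) := ⟨x, AddSubmonoid.subset_closure (by simp [F])⟩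
    let Y : AddSubmonoid.closure (F : Set M) := ⟨y, AddSubmonoid.subset_closure (by simp [F])⟩
    let Z : AddSubmonoid.closure (F : Set M) := ⟨z, AddSubmonoid.subset_closure (by simp [F])⟩
    have e1 : m • X + Z = m • Y := Subtype.ext hz
    have := TameAux.fg_unperf W.refinement W.fg m (W.f X) (W.f Y) hm
      ⟨W.f Z, by rw [← map_nsmul, ← map_nsmul, ← map_add, e1]⟩
    have h := TameAux.le_map W.g this
    rwa [W.factors, W.factors] at h
  · intro x1 x2 y1 y2 ⟨a, ha⟩ ⟨b, hb⟩ ⟨c, hc⟩ ⟨d, hd⟩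
    let F : Finset M := {x1, x2, y1, y2, a, b, c, d}
    obtain ⟨W⟩ := htame _ (fgs F)
    letI := W.instN
    have mem : ∀ t ∈ F, t ∈ AddSubmonoid.closure (F : Set M) :=
      fun t ht => AddSubmonoid.subset_closure ht
    let X1 : AddSubmonoid.closure (F : Set M) := ⟨x1, mem _ (by simp [F])⟩
    let X2 : AddSubmonoid.closure (F : Set M) := ⟨x2, mem _ (by simp [F])⟩
    let Y1 : AddSubmonoid.closure (F : Set M) := ⟨y1, mem _ (by simp [F])⟩
    let Y2 : AddSubmonoid.closure (F : Set M) := ⟨y2, mem _ (by simp [F])⟩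
    have e1 : AlgLE X1 Y1 := ⟨⟨a, mem _ (by simp [F])⟩, Subtype.ext ha⟩
    have e2 : AlgLE X1 Y2 := ⟨⟨b, mem _ (by simp [F])⟩, Subtype.ext hb⟩
    have e3 : AlgLE X2 Y1 := ⟨⟨c, mem _ (by simp [F])⟩, Subtype.ext hc⟩
    have e4 : AlgLE X2 Y2 := ⟨⟨d, mem _ (by simp [F])⟩, Subtype.ext hd⟩
    obtain ⟨z, h1, h2, h3, h4⟩ := TameAux.fg_interp W.refinement W.fg _ _ _ _
      (TameAux.le_map W.f e1) (TameAux.le_map W.f e2) (TameAux.le_map W.f e3)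
      (TameAux.le_map W.f e4)
    have h1 := TameAux.le_map W.g h1
    have h2 := TameAux.le_map W.g h2
    have h3 := TameAux.le_map W.g h3
    have h4 := TameAux.le_map W.g h4
    rw [W.factors] at h1 h2 h3 h4
    exact ⟨W.g z, h1, h2, h3, h4⟩
end

section
/- Let M be a tame refinement monoid and let J be an o-ideal of M. Then both J and the quotient monoid M/J are tame refinement monoids. -/
/-- The congruence `x ≡_J y` iff `x + a = y + b` for some `a, b ∈ J`; the quotient
monoid `M/J` is the quotient of `M` by this congruence. -/
def oIdealCon {M : Type*} [AddCommMonoid M] (J : AddSubmonoid M) : AddCon M where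
  r x y := ∃ a ∈ J, ∃ b ∈ J, x + a = y + b
  iseqv := by
    constructor
    · exact fun x => ⟨0, J.zero_mem, 0, J.zero_mem, rfl⟩
    · rintro x y ⟨a, ha, b, hb, h⟩
      exact ⟨b, hb, a, ha, h.symm⟩
    · rintro x y z ⟨a, ha, b, hb, h1⟩ ⟨c, hc, d, hd, h2⟩
      refine ⟨a + c, J.add_mem ha hc, d + b, J.add_mem hd hb, ?_⟩
      calc x + (a + c) = x + a + c := by rw [add_assoc]
        _ = y + b + c := by rw [h1]
        _ = y + c + b := by rw [add_right_comm]
        _ = z + d + b := by rw [h2]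
        _ = z + (d + b) := by rw [add_assoc]
  add' := by
    rintro w x y z ⟨a, ha, b, hb, h1⟩ ⟨c, hc, d, hd, h2⟩
    refine ⟨a + c, J.add_mem ha hc, b + d, J.add_mem hb hd, ?_⟩
    calc w + y + (a + c) = (w + a) + (y + c) := by abel
      _ = (x + b) + (z + d) := by rw [h1, h2]
      _ = x + z + (b + d) := by abel

theorem aux_redei {F : Type*} [AddCommMonoid F] (hF : AddMonoid.FG F) {S : Type*}
    [AddCommMonoid S] (π : F →+ S) :
    ∃ R : Finset (F × F), (∀ p ∈ R, π p.1 = π p.2) ∧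
      ∀ (Q : Type) [AddCommMonoid Q] (h : F →+ Q), (∀ p ∈ R, h p.1 = h p.2) →
        ∀ u v, π u = π v → h u = h v := by
  classical
  have := hF
  have : IsNoetherianRing (AddMonoidAlgebra ℤ F) :=
    Algebra.FiniteType.isNoetherianRing ℤ _
  let d : F × F → AddMonoidAlgebra ℤ F := fun p =>
    AddMonoidAlgebra.single p.1 1 - AddMonoidAlgebra.single p.2 1
  let T : Set (F × F) := {p | π p.1 = π p.2}
  have hfg : (Ideal.span (d '' T)).FG := IsNoetherian.noetherian _
  obtain ⟨t, ht, hts⟩ := Submodule.fg_span_iff_fg_span_finset_subset (d '' T) |>.1 hfg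
  obtain ⟨R, hR, hRt⟩ := Finset.subset_set_image_iff.1 ht
  refine ⟨R, fun p hp => hR hp, fun Q _ h hh u v huv => ?_⟩
  let φ := AddMonoidAlgebra.mapDomainRingHom ℤ h
  have hle : Ideal.span (d '' T) ≤ RingHom.ker φ := by
    have : Ideal.span (d '' T) = Ideal.span (t : Set _) := hts
    rw [this, Ideal.span_le]
    intro x hx
    rw [← hRt] at hx
    obtain ⟨p, hp, rfl⟩ := Finset.mem_image.1 (Finset.mem_coe.1 hx)
    change φ (_ - _) = 0
    rw [map_sub]
    simp [φ, hh p hp]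
  have hm : d (u, v) ∈ RingHom.ker φ := hle (Ideal.subset_span ⟨(u, v), huv, rfl⟩)
  have h2 : (AddMonoidAlgebra.single (h u) 1 : AddMonoidAlgebra ℤ Q)
      = AddMonoidAlgebra.single (h v) 1 := by
    change φ (_ - _) = 0 at hm
    rw [map_sub, sub_eq_zero] at hm
    simpa [φ] using hm
  exact AddMonoidAlgebra.single_left_injective one_ne_zero h2

theorem aux_ideal_ref {M : Type*} [AddCommMonoid M] (href : IsRefinementAddMonoid M)
    (J : AddSubmonoid M) (hher : ∀ x y : M, y ∈ J → AlgLE x y → x ∈ J) :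
    IsRefinementAddMonoid J := by
  rintro ⟨x1, h1⟩ ⟨x2, h2⟩ ⟨y1, h3⟩ ⟨y2, h4⟩ h
  obtain ⟨a, b, c, d, e1, e2, e3, e4⟩ := href x1 x2 y1 y2 (congrArg Subtype.val h)
  refine ⟨⟨a, hher _ _ h1 ⟨b, e1.symm⟩⟩, ⟨b, hher _ _ h4 ⟨d, e4.symm⟩⟩,
    ⟨c, hher _ _ h2 ⟨d, e2.symm⟩⟩, ⟨d, hher _ _ h4 ⟨b, by rw [e4, add_comm]⟩⟩, ?_, ?_, ?_, ?_⟩ <;>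
  exact Subtype.ext (by assumption)

theorem aux_ideal_fg {N : Type*} [AddCommMonoid N] (hN : AddMonoid.FG N)
    (J : AddSubmonoid N) (hher : ∀ x y : N, y ∈ J → AlgLE x y → x ∈ J) :
    AddMonoid.FG J := by
  classical
  obtain ⟨s, hs⟩ := hN.1
  rw [AddMonoid.fg_iff_addSubmonoid_fg]
  refine ⟨s.filter (· ∈ J), le_antisymm ?_ ?_⟩
  · rw [AddSubmonoid.closure_le]
    intro x hx
    simpa using (Finset.mem_filter.1 hx).2
  · intro x hx
    have key : ∀ y ∈ AddSubmonoid.closure (s : Set N), y ∈ J →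
        y ∈ AddSubmonoid.closure ((s.filter (· ∈ J) : Finset N) : Set N) := by
      intro y hy
      induction hy using AddSubmonoid.closure_induction with
      | mem y hy => exact fun h => AddSubmonoid.subset_closure (by simpa using ⟨hy, h⟩)
      | zero => exact fun _ => zero_mem _
      | add a b _ _ iha ihb =>
        intro h
        exact add_mem (iha (hher _ _ h ⟨b, rfl⟩)) (ihb (hher _ _ h ⟨a, add_comm _ _⟩))
    exact key x (by rw [hs]; trivial) hx

theorem aux_quot_zero {M : Type*} [AddCommMonoid M] (J : AddSubmonoid M) {a : M} (ha : a ∈ J) :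
    (oIdealCon J).mk' a = 0 := by
  rw [← map_zero (oIdealCon J).mk']
  exact (AddCon.eq _).2 ⟨0, J.zero_mem, a, ha, by simp⟩

theorem aux_quot_ref {M : Type*} [AddCommMonoid M] (href : IsRefinementAddMonoid M)
    (J : AddSubmonoid M) : IsRefinementAddMonoid (oIdealCon J).Quotient := by
  intro X1 X2 Y1 Y2 h
  obtain ⟨x1, rfl⟩ := (oIdealCon J).mk'_surjective X1
  obtain ⟨x2, rfl⟩ := (oIdealCon J).mk'_surjective X2
  obtain ⟨y1, rfl⟩ := (oIdealCon J).mk'_surjective Y1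
  obtain ⟨y2, rfl⟩ := (oIdealCon J).mk'_surjective Y2
  rw [← map_add, ← map_add] at h
  obtain ⟨a, ha, b, hb, e⟩ := (AddCon.eq _).1 h
  obtain ⟨p, q, r, s, e1, e2, e3, e4⟩ := href x1 (x2 + a) y1 (y2 + b)
    (by rw [← add_assoc, ← add_assoc, e])
  refine ⟨(oIdealCon J).mk' p, (oIdealCon J).mk' q, (oIdealCon J).mk' r, (oIdealCon J).mk' s,
    ?_, ?_, ?_, ?_⟩ <;> rw [← map_add]
  · rw [e1]
  · rw [← e2, map_add, aux_quot_zero J ha, add_zero]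
  · rw [e3]
  · rw [← e4, map_add, aux_quot_zero J hb, add_zero]

theorem aux_comap {M N : Type*} [AddCommMonoid M] [AddCommMonoid N] (g : N →+ M)
    (J : AddSubmonoid M) (hher : ∀ x y : M, y ∈ J → AlgLE x y → x ∈ J) :
    ∀ x y : N, y ∈ J.comap g → AlgLE x y → x ∈ J.comap g := by
  rintro x y hy ⟨z, rfl⟩
  exact hher _ _ hy ⟨g z, (map_add g x z).symm⟩

theorem aux_ideal_tame {M : Type*} [AddCommMonoid M] (htame : IsTame M)
    (J : AddSubmonoid M) (hher : ∀ x y : M, y ∈ J → AlgLE x y → x ∈ J) : IsTame J := by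
  intro S hS
  obtain ⟨N, hfg, hr, f, g, hfac⟩ := htame (S.map J.subtype) (hS.map _)
  let ι : S →+ S.map J.subtype :=
    (J.subtype.comp S.subtype).codRestrict _ (fun s => ⟨s.1, s.2, rfl⟩)
  have hι : ∀ s : S, g (f (ι s)) = ((s : J) : M) := fun s => hfac (ι s)
  exact ⟨{
    N := J.comap g
    fg := aux_ideal_fg hfg _ (aux_comap g J hher)
    refinement := aux_ideal_ref hr _ (aux_comap g J hher)
    f := (f.comp ι).codRestrict _ (fun s => by
      change g (f (ι s)) ∈ J
      rw [hι]; exact s.1.2)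
    g := (g.comp (J.comap g).subtype).codRestrict J (fun x => x.2)
    factors := fun s => Subtype.ext (hι s) }⟩

theorem aux_quot_tame {M : Type*} [AddCommMonoid M] (htame : IsTame M)
    (J : AddSubmonoid M) : IsTame (oIdealCon J).Quotient := by
  classical
  intro S hS
  obtain ⟨t, rfl⟩ := hS
  let q := (oIdealCon J).mk'
  have hq : Function.Surjective q := (oIdealCon J).mk'_surjective
  let t' : Finset M := t.image (Function.surjInv hq)
  let F : AddSubmonoid M := AddSubmonoid.closure (t' : Set M)
  have hFmap : F.map q = AddSubmonoid.closure (t : Set _) := by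
    rw [AddMonoidHom.map_mclosure]
    congr 1
    simp only [t', Finset.coe_image, Set.image_image, Function.surjInv_eq hq, Set.image_id']
  have hFfg : AddMonoid.FG F := (AddMonoid.fg_iff_addSubmonoid_fg F).2 ⟨t', rfl⟩
  obtain ⟨R, hR, hRed⟩ := aux_redei hFfg (q.comp F.subtype)
  have hR' : ∀ p : F × F, ∃ ab : M × M, p ∈ R → ab.1 ∈ J ∧ ab.2 ∈ J ∧
      (p.1 : M) + ab.1 = p.2 + ab.2 := by
    intro p
    by_cases hp : p ∈ R
    · obtain ⟨a, ha, b, hb, e⟩ := (AddCon.eq _).1 (hR p hp)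
      exact ⟨(a, b), fun _ => ⟨ha, hb, e⟩⟩
    · exact ⟨0, fun h => absurd h hp⟩
  choose ab hab using hR'
  let G : Finset M := t' ∪ (R.image (fun p => (ab p).1) ∪ R.image (fun p => (ab p).2))
  let M' : AddSubmonoid M := AddSubmonoid.closure (G : Set M)
  have hFM : F ≤ M' := AddSubmonoid.closure_mono (by
    intro x hx; exact Finset.mem_coe.2 (Finset.mem_union_left _ hx))
  have h1 : ∀ p ∈ R, (ab p).1 ∈ M' := fun p hp => AddSubmonoid.subset_closure
    (Finset.mem_coe.2 (Finset.mem_union_right _ (Finset.mem_union_left _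
      (Finset.mem_image_of_mem _ hp))))
  have h2 : ∀ p ∈ R, (ab p).2 ∈ M' := fun p hp => AddSubmonoid.subset_closure
    (Finset.mem_coe.2 (Finset.mem_union_right _ (Finset.mem_union_right _
      (Finset.mem_image_of_mem _ hp))))
  obtain ⟨N, hfg, hr, f, g, hfac⟩ := htame M' ⟨G, rfl⟩
  let K := J.comap g
  let qN := (oIdealCon K).mk'
  let h : F →+ (oIdealCon K).Quotient := qN.comp (f.comp (AddSubmonoid.inclusion hFM))
  have hwell := hRed _ h (by
    intro p hp
    obtain ⟨ha, hb, e⟩ := hab p hp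
    refine (AddCon.eq _).2 ⟨f ⟨_, h1 p hp⟩, ?_, f ⟨_, h2 p hp⟩, ?_, ?_⟩
    · change g _ ∈ J
      rw [hfac]; exact ha
    · change g _ ∈ J
      rw [hfac]; exact hb
    · change f _ + _ = f _ + _
      rw [← map_add, ← map_add]
      exact congrArg f (Subtype.ext e))
  have hlift : ∀ s : AddSubmonoid.closure (t : Set (oIdealCon J).Quotient),
      ∃ x : F, q x = s := by
    rintro ⟨s, hs⟩
    rw [← hFmap] at hs
    obtain ⟨x, hx, rfl⟩ := hs
    exact ⟨⟨x, hx⟩, rfl⟩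
  choose σ hσ using hlift
  let g' : (oIdealCon K).Quotient →+ (oIdealCon J).Quotient :=
    (oIdealCon K).lift (q.comp g) (by
      rintro x y ⟨a, ha, b, hb, e⟩
      refine (AddCon.eq _).2 ⟨g a, ha, g b, hb, ?_⟩
      rw [← map_add, ← map_add, e])
  exact ⟨{
    N := (oIdealCon K).Quotient
    fg := by
      have := hfg
      exact AddMonoid.fg_of_surjective qN (oIdealCon K).mk'_surjective
    refinement := aux_quot_ref hr K
    f := {
      toFun := fun s => h (σ s)
      map_zero' := by
        rw [← map_zero h]
        apply hwell
        change q (σ 0) = q 0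
        rw [hσ, map_zero]; rfl
      map_add' := fun x y => by
        rw [← map_add h]
        apply hwell
        change q (σ (x + y)) = q ((σ x : M) + σ y)
        rw [hσ, map_add, hσ, hσ]; rfl }
    g := g'
    factors := fun s => by
      change q (g (f _)) = _
      rw [hfac]
      exact hσ s }⟩

/-- If `M` is a tame refinement monoid and `J` an o-ideal of `M`, then both `J` and the
quotient monoid `M/J` are tame refinement monoids. -/
theorem oIdeal_and_quotient_tame
    (M : Type*) [AddCommMonoid M] (href : IsRefinementAddMonoid M) (htame : IsTame M)
    (J : AddSubmonoid M) (hher : ∀ x y : M, y ∈ J → AlgLE x y → x ∈ J) :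
    (IsRefinementAddMonoid ↥J ∧ IsTame ↥J) ∧
    (IsRefinementAddMonoid (oIdealCon J).Quotient ∧ IsTame (oIdealCon J).Quotient) :=
  ⟨⟨aux_ideal_ref href J hher, aux_ideal_tame htame J hher⟩,
    aux_quot_ref href J, aux_quot_tame htame J⟩
end

section
/- A retract of a tame refinement monoid is a tame refinement monoid: if M is a tame refinement monoid and N is a commutative monoid with monoid homomorphisms i : N → M and r : M → N satisfying r ∘ i = id_N, then N is a tame refinement monoid. Moreover, the direct sum of any family of tame refinement monoids is a tame refinement monoid. -/
theorem refine_dfinsupp {ι : Type*} (M : ι → Type*) [∀ i, AddCommMonoid (M i)]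
    (h : ∀ i, IsRefinementAddMonoid (M i)) : IsRefinementAddMonoid (DirectSum ι M) := by
  classical
  intro x1 x2 y1 y2 e
  have e' : ∀ i, x1 i + x2 i = y1 i + y2 i := fun i => by
    rw [← DirectSum.add_apply, e, DirectSum.add_apply]
  choose a b c d h1 h2 h3 h4 using fun i => h i _ _ _ _ (e' i)
  let T : Finset ι := DFinsupp.support x1 ∪ DFinsupp.support x2 ∪
    DFinsupp.support y1 ∪ DFinsupp.support y2
  have key : ∀ (x : DirectSum ι M) (u v : ∀ i, M i), (∀ i, x i = u i + v i) →
      (∀ i, i ∉ T → x i = 0) →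
      x = DirectSum.mk M T (fun i => u i) + DirectSum.mk M T (fun i => v i) := by
    intro x u v hx hT
    refine DFinsupp.ext fun i => ?_
    rw [DirectSum.add_apply]
    by_cases hi : i ∈ T
    · rw [DirectSum.mk_apply_of_mem hi, DirectSum.mk_apply_of_mem hi]
      exact hx i
    · rw [DirectSum.mk_apply_of_notMem hi, DirectSum.mk_apply_of_notMem hi, add_zero]
      exact hT i hi
  have hz : ∀ i, i ∉ T → x1 i = 0 ∧ x2 i = 0 ∧ y1 i = 0 ∧ y2 i = 0 := by
    intro i hi
    simp only [T, Finset.mem_union, DFinsupp.mem_support_iff, not_or, not_not] at hi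
    exact ⟨hi.1.1.1, hi.1.1.2, hi.1.2, hi.2⟩
  exact ⟨DirectSum.mk M T (fun i => a i), DirectSum.mk M T (fun i => b i),
    DirectSum.mk M T (fun i => c i), DirectSum.mk M T (fun i => d i),
    key _ _ _ h1 fun i hi => (hz i hi).1,
    key _ _ _ h2 fun i hi => (hz i hi).2.1,
    key _ _ _ h3 fun i hi => (hz i hi).2.2.1,
    key _ _ _ h4 fun i hi => (hz i hi).2.2.2⟩

theorem refine_pi {ι : Type*} (M : ι → Type*) [∀ i, AddCommMonoid (M i)]
    (h : ∀ i, IsRefinementAddMonoid (M i)) : IsRefinementAddMonoid (∀ i, M i) := by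
  intro x1 x2 y1 y2 e
  choose a b c d h1 h2 h3 h4 using fun i => h i _ _ _ _ (congrFun e i)
  exact ⟨a, b, c, d, funext h1, funext h2, funext h3, funext h4⟩

theorem fg_pi {n : ℕ} (M : Fin n → Type) [∀ i, AddCommMonoid (M i)]
    (h : ∀ i, AddMonoid.FG (M i)) : AddMonoid.FG (∀ i, M i) := by
  have : ∀ i, Module.Finite ℕ (M i) := fun i => Module.Finite.iff_addMonoid_fg.2 (h i)
  exact Module.Finite.iff_addMonoid_fg.1 inferInstance

theorem tame_directSum {ι : Type*} (M : ι → Type*) [∀ i, AddCommMonoid (M i)]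
    (h : ∀ i, IsRefinementAddMonoid (M i) ∧ IsTame (M i)) : IsTame (DirectSum ι M) := by
  classical
  intro S hS
  obtain ⟨G, hG⟩ := id hS
  let T : Finset ι := G.biUnion fun x => DFinsupp.support x
  have hT : ∀ s ∈ S, ∀ i, i ∉ T → s i = 0 := by
    intro s hs i hi
    rw [← hG] at hs
    induction hs using AddSubmonoid.closure_induction with
    | mem x hx =>
      by_contra hne
      exact hi (Finset.mem_biUnion.2 ⟨x, hx, DFinsupp.mem_support_iff.2 hne⟩)
    | zero => rfl
    | add x y _ _ hx hy => rw [DirectSum.add_apply, hx, hy, add_zero]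
  let p : ∀ i, DirectSum ι M →+ M i := fun i => DFinsupp.evalAddMonoidHom i
  have w : ∀ i, Nonempty (TameWitness (M i) (S.map (p i))) := fun i =>
    (h i).2 _ (hS.map (p i))
  let W := fun i => Classical.choice (w i)
  letI : ∀ i, AddCommMonoid (W i).N := fun i => (W i).instN
  let e := T.equivFin
  let q : ∀ i, S →+ S.map (p i) := fun i => (p i).addSubmonoidMap S
  refine ⟨{
    N := ∀ k : Fin T.card, (W (e.symm k)).N
    fg := fg_pi _ fun k => (W _).fg
    refinement := refine_pi _ fun k => (W _).refinement
    f := AddMonoidHom.pi fun k => ((W (e.symm k)).f.comp (q _))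
    g := ∑ k : Fin T.card, (DirectSum.of M (e.symm k)).comp
      ((W (e.symm k)).g.comp (Pi.evalAddMonoidHom _ k))
    factors := ?_ }⟩
  intro s
  rw [AddMonoidHom.finsetSum_apply]
  have : ∀ k : Fin T.card, ((DirectSum.of M (e.symm k)).comp
      ((W (e.symm k)).g.comp (Pi.evalAddMonoidHom (fun k => (W (e.symm k)).N) k)))
      ((AddMonoidHom.pi fun k => ((W (e.symm k)).f.comp (q (e.symm k)))) s) =
      DirectSum.of M (e.symm k) ((s : DirectSum ι M) (e.symm k)) := by
    intro k
    exact congrArg (DirectSum.of M (e.symm k)) ((W (e.symm k)).factors (q _ s))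
  rw [Finset.sum_congr rfl fun k _ => this k]
  rw [e.symm.sum_comp (fun t : T => DirectSum.of M t ((s : DirectSum ι M) t))]
  rw [Finset.sum_coe_sort T (fun t => DirectSum.of M t ((s : DirectSum ι M) t))]
  conv_rhs => rw [← DirectSum.sum_support_of (s : DirectSum ι M)]
  symm
  apply Finset.sum_subset
  · intro i hi
    by_contra hn
    exact DFinsupp.mem_support_iff.1 hi (hT s s.2 i hn)
  · intro i _ hi
    rw [DFinsupp.notMem_support_iff.1 hi, map_zero]

/-- A retract of a tame refinement monoid is a tame refinement monoid, and the direct sum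
of any family of tame refinement monoids is a tame refinement monoid. -/
theorem retract_and_directSum_of_tame :
    (∀ (M : Type*) (N : Type*) [AddCommMonoid M] [AddCommMonoid N],
      IsRefinementAddMonoid M → IsTame M →
      ∀ (i : N →+ M) (r : M →+ N), r.comp i = AddMonoidHom.id N →
        IsRefinementAddMonoid N ∧ IsTame N) ∧
    (∀ (ι : Type*) (M : ι → Type*) [∀ i, AddCommMonoid (M i)],
      (∀ i, IsRefinementAddMonoid (M i) ∧ IsTame (M i)) →
        IsRefinementAddMonoid (DirectSum ι M) ∧ IsTame (DirectSum ι M)) := by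
  refine ⟨?_, fun ι M _ h => ⟨refine_dfinsupp M fun i => (h i).1, tame_directSum M h⟩⟩
  intro M N _ _ hM hT i r hri
  have hr : ∀ x, r (i x) = x := fun x => DFunLike.congr_fun hri x
  constructor
  · intro x1 x2 y1 y2 e
    obtain ⟨a, b, c, d, h1, h2, h3, h4⟩ := hM (i x1) (i x2) (i y1) (i y2)
      (by rw [← map_add, e, map_add])
    refine ⟨r a, r b, r c, r d, ?_, ?_, ?_, ?_⟩ <;> rw [← map_add]
    · rw [← h1, hr]
    · rw [← h2, hr]
    · rw [← h3, hr]
    · rw [← h4, hr]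
  · intro S hS
    obtain ⟨W⟩ := hT (S.map i) (hS.map i)
    letI := W.instN
    exact ⟨{
      N := W.N
      fg := W.fg
      refinement := W.refinement
      f := W.f.comp (i.addSubmonoidMap S)
      g := r.comp W.g
      factors := fun s => (congrArg r (W.factors (i.addSubmonoidMap S s))).trans (hr s) }⟩
end

section
/- If M is a tame refinement monoid, then its maximal antisymmetric quotient M/≡, where ≡ is the congruence defined by x ≡ y if and only if x ≤ y and y ≤ x in the algebraic ordering, is a conical tame refinement monoid. -/
/-- The congruence `x ≡ y` iff `x ≤ y ≤ x` in the algebraic ordering; the quotient is the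
maximal antisymmetric quotient of `M`. -/
def mutualLECon (M : Type*) [AddCommMonoid M] : AddCon M where
  r x y := AlgLE x y ∧ AlgLE y x
  iseqv := by
    constructor
    · exact fun x => ⟨⟨0, add_zero x⟩, ⟨0, add_zero x⟩⟩
    · rintro x y ⟨h1, h2⟩
      exact ⟨h2, h1⟩
    · rintro x y z ⟨⟨u, hu⟩, ⟨v, hv⟩⟩ ⟨⟨s, hs⟩, ⟨t, ht⟩⟩
      exact ⟨⟨u + s, by rw [← add_assoc, hu, hs]⟩, ⟨t + v, by rw [← add_assoc, ht, hv]⟩⟩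
  add' := by
    rintro w x y z ⟨⟨u, hu⟩, ⟨v, hv⟩⟩ ⟨⟨s, hs⟩, ⟨t, ht⟩⟩
    constructor
    · refine ⟨u + s, ?_⟩
      calc w + y + (u + s) = (w + u) + (y + s) := by abel
        _ = x + z := by rw [hu, hs]
    · refine ⟨v + t, ?_⟩
      calc x + z + (v + t) = (x + v) + (z + t) := by abel
        _ = w + y := by rw [hv, ht]

theorem AlgLE.refl' {M : Type*} [AddCommMonoid M] (x : M) : AlgLE x x := ⟨0, add_zero x⟩

theorem AlgLE.trans' {M : Type*} [AddCommMonoid M] {x y z : M} (h : AlgLE x y)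
    (h' : AlgLE y z) : AlgLE x z := by
  obtain ⟨u, rfl⟩ := h
  obtain ⟨v, rfl⟩ := h'
  exact ⟨u + v, by abel⟩

theorem AlgLE.add' {M : Type*} [AddCommMonoid M] {x y z w : M} (h : AlgLE x y)
    (h' : AlgLE z w) : AlgLE (x + z) (y + w) := by
  obtain ⟨u, rfl⟩ := h
  obtain ⟨v, rfl⟩ := h'
  exact ⟨u + v, by abel⟩

theorem AlgLE.self_add {M : Type*} [AddCommMonoid M] (x y : M) : AlgLE x (x + y) := ⟨y, rfl⟩

theorem AlgLE.map' {M N : Type*} [AddCommMonoid M] [AddCommMonoid N] (g : N →+ M) {x y : N}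
    (h : AlgLE x y) : AlgLE (g x) (g y) := by
  obtain ⟨u, rfl⟩ := h
  exact ⟨g u, (map_add g x u).symm⟩

theorem algLE_wqo {N : Type*} [AddCommMonoid N] (h : AddMonoid.FG N) :
    ∀ f : ℕ → N, ∃ m n, m < n ∧ AlgLE (f m) (f n) := by
  intro f
  have : Module.Finite ℕ N := Module.Finite.iff_addMonoid_fg.2 h
  obtain ⟨k, φ, hφ⟩ := Module.Finite.exists_fin' ℕ N
  choose s hs using hφ
  obtain ⟨m, n, hmn, hle⟩ := (wellQuasiOrdered_le (α := Fin k → ℕ)) (fun i => s (f i))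
  refine ⟨m, n, hmn, φ (s (f n) - s (f m)), ?_⟩
  rw [← hs (f m), ← hs (f n), ← map_add]
  congr 1
  simp only [hs]
  exact add_tsub_cancel_of_le hle

/-- primes, units allowed -/
def PrimeLike {N : Type*} [AddCommMonoid N] (p : N) : Prop :=
  ∀ a b, AlgLE p (a + b) → AlgLE p a ∨ AlgLE p b

theorem algLE_wf {N : Type*} [AddCommMonoid N] (h : AddMonoid.FG N) :
    WellFounded (fun x y : N => AlgLE x y ∧ ¬ AlgLE y x) := by
  have : IsTrans N (fun x y : N => AlgLE x y ∧ ¬ AlgLE y x) :=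
    ⟨fun a b c h1 h2 => ⟨h1.1.trans' h2.1, fun h3 => h1.2 (h2.1.trans' h3)⟩⟩
  have : IsStrictOrder N (fun x y : N => AlgLE x y ∧ ¬ AlgLE y x) :=
    { irrefl := fun a h => h.2 h.1 }
  rw [RelEmbedding.wellFounded_iff_isEmpty]
  refine ⟨fun e => ?_⟩
  obtain ⟨m, n, hmn, hle⟩ := algLE_wqo h e
  exact (e.map_rel_iff.2 hmn).2 hle

theorem prime_induction {N : Type*} [AddCommMonoid N] (h : AddMonoid.FG N)
    (href : IsRefinementAddMonoid N) (P : N → Prop) (hadd : ∀ a b, P a → P b → P (a + b))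
    (hp : ∀ p, PrimeLike p → P p) : ∀ u, P u := by
  intro u
  induction u using (algLE_wf h).induction with
  | _ x ih =>
    by_cases hx : ∃ a b, x = a + b ∧ ¬ AlgLE x a ∧ ¬ AlgLE x b
    · obtain ⟨a, b, rfl, ha, hb⟩ := hx
      exact hadd _ _ (ih a ⟨AlgLE.self_add a b, ha⟩)
        (ih b ⟨by rw [add_comm]; exact AlgLE.self_add b a, hb⟩)
    · push Not at hx
      apply hp
      rintro a b ⟨t, ht⟩
      obtain ⟨z11, z12, z21, z22, h1, h2, h3, h4⟩ := href _ _ _ _ ht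
      by_cases h5 : AlgLE x z11
      · left; rw [h3]; exact h5.trans' (AlgLE.self_add _ _)
      · right; rw [h4]; exact (hx _ _ h1 h5).trans' (AlgLE.self_add _ _)

theorem prime_split {N : Type*} [AddCommMonoid N]
    (href : IsRefinementAddMonoid N) {p w : N} (hp : PrimeLike p) (hw : AlgLE p w) (n : ℕ) :
    ∀ x1 x2, AlgLE (n • w) (x1 + x2) →
      ∃ i j, i + j = n ∧ AlgLE (i • p) x1 ∧ AlgLE (j • p) x2 := by
  induction n with
  | zero =>
    intro x1 x2 _
    exact ⟨0, 0, rfl, ⟨x1, by simp⟩, ⟨x2, by simp⟩⟩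
  | succ n ih =>
    rintro x1 x2 ⟨t, ht⟩
    rw [succ_nsmul', add_assoc] at ht
    obtain ⟨a, b, c, d, h1, h2, rfl, rfl⟩ := href _ _ _ _ ht
    obtain ⟨i, j, hij, hi, hj⟩ := ih c d ⟨t, h2⟩
    rw [h1] at hw
    rcases hp _ _ hw with h | h
    · exact ⟨i + 1, j, by omega, by rw [succ_nsmul']; exact h.add' hi,
        hj.trans' ⟨b, add_comm _ _⟩⟩
    · exact ⟨i, j + 1, by omega, hi.trans' ⟨a, add_comm _ _⟩,
        by rw [succ_nsmul']; exact h.add' hj⟩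

theorem absorb_of_all {N : Type*} [AddCommMonoid N] (h : AddMonoid.FG N) {p x : N}
    (hx : ∀ n : ℕ, AlgLE (n • p) x) : AlgLE (x + p) x := by
  choose r hr using hx
  obtain ⟨m, n, hmn, s, hs⟩ := algLE_wqo h r
  obtain ⟨k, rfl⟩ := Nat.exists_eq_add_of_lt hmn
  refine ⟨k • p + s, ?_⟩
  have h1 := hr (m + k + 1)
  rw [← hs] at h1
  calc x + p + (k • p + s) = (m • p + r m) + p + (k • p + s) := by rw [hr m]
    _ = (m + k + 1) • p + (r m + s) := by rw [add_nsmul, add_nsmul, one_nsmul]; abel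
    _ = x := h1

theorem nsmul_le_mono {N : Type*} [AddCommMonoid N] {p x : N} {m n : ℕ} (h : m ≤ n)
    (hx : AlgLE (n • p) x) : AlgLE (m • p) x := by
  obtain ⟨k, rfl⟩ := Nat.exists_eq_add_of_le h
  rw [add_nsmul] at hx
  exact (AlgLE.self_add _ _).trans' hx

theorem prime_absorb {N : Type*} [AddCommMonoid N] (h : AddMonoid.FG N)
    (href : IsRefinementAddMonoid N) {p : N} (hp : PrimeLike p) {x1 x2 : N}
    (hx : AlgLE (x1 + x2 + p) (x1 + x2)) : AlgLE (x1 + p) x1 ∨ AlgLE (x2 + p) x2 := by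
  have hn : ∀ n : ℕ, AlgLE (x1 + x2 + n • p) (x1 + x2) := by
    intro n
    induction n with
    | zero => rw [zero_nsmul, add_zero]; exact AlgLE.refl' _
    | succ n ih =>
      rw [succ_nsmul, ← add_assoc]
      exact (ih.add' (AlgLE.refl' p)).trans' hx
  by_contra hcon
  push Not at hcon
  have h1 : ∃ n : ℕ, ¬ AlgLE (n • p) x1 := by
    by_contra hh; push Not at hh; exact hcon.1 (absorb_of_all h hh)
  have h2 : ∃ n : ℕ, ¬ AlgLE (n • p) x2 := by
    by_contra hh; push Not at hh; exact hcon.2 (absorb_of_all h hh)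
  obtain ⟨m, hm⟩ := h1
  obtain ⟨n, hn'⟩ := h2
  obtain ⟨i, j, hij, hi, hj⟩ := prime_split href hp (AlgLE.refl' p) (m + n) x1 x2
    (AlgLE.trans' ⟨x1 + x2, add_comm _ _⟩ (hn (m + n)))
  rcases le_or_gt m i with hmi | hmi
  · exact hm (nsmul_le_mono hmi hi)
  · exact hn' (nsmul_le_mono (by omega) hj)

theorem absorb_split {N : Type*} [AddCommMonoid N] (h : AddMonoid.FG N)
    (href : IsRefinementAddMonoid N) (x1 x2 u : N) (hu : AlgLE (x1 + x2 + u) (x1 + x2)) :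
    ∃ v1 v2, u = v1 + v2 ∧ AlgLE (x1 + v1) x1 ∧ AlgLE (x2 + v2) x2 := by
  revert hu
  induction u using prime_induction h href with
  | hadd a b ha hb =>
    intro hu
    rw [← add_assoc] at hu
    obtain ⟨v1, v2, rfl, h1, h2⟩ := ha ((AlgLE.self_add _ _).trans' hu)
    obtain ⟨w1, w2, rfl, h3, h4⟩ := hb (AlgLE.trans' ⟨v1 + v2, by abel⟩ hu)
    refine ⟨v1 + w1, v2 + w2, by abel, ?_, ?_⟩
    · rw [← add_assoc]; exact (h1.add' (AlgLE.refl' w1)).trans' h3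
    · rw [← add_assoc]; exact (h2.add' (AlgLE.refl' w2)).trans' h4
  | hp p hp =>
    intro hu
    rcases prime_absorb h href hp hu with h1 | h1
    · exact ⟨p, 0, by simp, h1, by rw [add_zero]; exact AlgLE.refl' _⟩
    · exact ⟨0, p, by simp, by rw [add_zero]; exact AlgLE.refl' _, h1⟩

theorem fg_refine {N : Type*} [AddCommMonoid N] (h : AddMonoid.FG N)
    (href : IsRefinementAddMonoid N) (x1 x2 y1 y2 : N) (hxy : mutualLECon N (x1 + x2) (y1 + y2)) :
    ∃ z11 z12 z21 z22 : N, mutualLECon N x1 (z11 + z12) ∧ mutualLECon N x2 (z21 + z22) ∧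
      y1 = z11 + z21 ∧ y2 = z12 + z22 := by
  obtain ⟨⟨u, hu⟩, hv⟩ := hxy
  have hux : AlgLE (x1 + x2 + u) (x1 + x2) := by rw [hu]; exact hv
  have hu' : x1 + (x2 + u) = y1 + y2 := by rw [← hu]; abel
  obtain ⟨a, b, c, d, rfl, h2, rfl, rfl⟩ := href _ _ _ _ hu'
  obtain ⟨c1, d1, e, f, rfl, rfl, rfl, rfl⟩ := href _ _ _ _ h2
  obtain ⟨e1, e2, rfl, he1, he2⟩ := absorb_split h href (a + b) (c1 + d1) e
    (AlgLE.trans' ⟨f, by abel⟩ hux)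
  obtain ⟨f1, f2, rfl, hf1, hf2⟩ := absorb_split h href (a + b) (c1 + d1) f
    (AlgLE.trans' ⟨e1 + e2, by abel⟩ hux)
  refine ⟨a + e1, b + f1, c1 + e2, d1 + f2, ⟨⟨e1 + f1, by abel⟩, ?_⟩,
    ⟨⟨e2 + f2, by abel⟩, ?_⟩, by abel, by abel⟩
  · have := (he1.add' (AlgLE.refl' f1)).trans' hf1
    rwa [show a + b + e1 + f1 = a + e1 + (b + f1) by abel] at this
  · have := (he2.add' (AlgLE.refl' f2)).trans' hf2
    rwa [show c1 + d1 + e2 + f2 = c1 + e2 + (d1 + f2) by abel] at this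

theorem fg_quot_refinement {N : Type*} [AddCommMonoid N] (h : AddMonoid.FG N)
    (href : IsRefinementAddMonoid N) : IsRefinementAddMonoid (mutualLECon N).Quotient := by
  intro x1 x2 y1 y2
  induction x1, x2 using AddCon.induction_on₂ with | _ x1 x2
  induction y1, y2 using AddCon.induction_on₂ with | _ y1 y2
  intro hxy
  rw [← AddCon.coe_add, ← AddCon.coe_add, AddCon.eq] at hxy
  obtain ⟨a, b, c, d, h1, h2, h3, h4⟩ := fg_refine h href _ _ _ _ hxy
  refine ⟨a, b, c, d, ?_, ?_, ?_, ?_⟩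
  · rw [← AddCon.coe_add, AddCon.eq]; exact h1
  · rw [← AddCon.coe_add, AddCon.eq]; exact h2
  · rw [← AddCon.coe_add, h3]
  · rw [← AddCon.coe_add, h4]

/-- The map induced on maximal antisymmetric quotients. -/
def quotMap {M N : Type*} [AddCommMonoid M] [AddCommMonoid N] (g : N →+ M) :
    (mutualLECon N).Quotient →+ (mutualLECon M).Quotient :=
  (mutualLECon N).lift ((mutualLECon M).mk'.comp g) (by
    intro x y hxy
    rw [AddCon.ker_rel]
    exact (AddCon.eq _).2 ⟨hxy.1.map' g, hxy.2.map' g⟩)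

theorem quotMap_coe {M N : Type*} [AddCommMonoid M] [AddCommMonoid N] (g : N →+ M) (x : N) :
    quotMap g (x : (mutualLECon N).Quotient) = ((g x : M) : (mutualLECon M).Quotient) := rfl

/-- Redei -/
theorem redei {k : ℕ} {S : Type*} [AddCommMonoid S] (φ : (Fin k →₀ ℕ) →+ S) :
    ∃ P : Finset ((Fin k →₀ ℕ) × (Fin k →₀ ℕ)), (∀ q ∈ P, φ q.1 = φ q.2) ∧
      ∀ (K : Type) [AddCommMonoid K] (ψ : (Fin k →₀ ℕ) →+ K), (∀ q ∈ P, ψ q.1 = ψ q.2) →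
        ∀ a b, φ a = φ b → ψ a = ψ b := by
  classical
  let d : (Fin k →₀ ℕ) × (Fin k →₀ ℕ) → AddMonoidAlgebra ℤ (Fin k →₀ ℕ) :=
    fun q => AddMonoidAlgebra.single q.1 1 - AddMonoidAlgebra.single q.2 1
  have : IsNoetherianRing (AddMonoidAlgebra ℤ (Fin k →₀ ℕ)) :=
    inferInstanceAs (IsNoetherianRing (MvPolynomial (Fin k) ℤ))
  have hfg := IsNoetherian.noetherian
    (Submodule.span (AddMonoidAlgebra ℤ (Fin k →₀ ℕ)) (d '' {q | φ q.1 = φ q.2}))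
  rw [Submodule.fg_span_iff_fg_span_finset_subset] at hfg
  obtain ⟨T, hT, hspan⟩ := hfg
  obtain ⟨P, hP, rfl⟩ := Finset.subset_set_image_iff.1 hT
  refine ⟨P, fun q hq => hP hq, ?_⟩
  intro K _ ψ hψ a b hab
  let F := AddMonoidAlgebra.mapDomainRingHom ℤ ψ
  have hle : Ideal.span (↑(P.image d) : Set (AddMonoidAlgebra ℤ (Fin k →₀ ℕ))) ≤
      RingHom.ker F := by
    rw [Ideal.span_le]
    intro y hy
    obtain ⟨q, hq, rfl⟩ := Finset.mem_image.1 (Finset.mem_coe.1 hy)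
    change d q ∈ RingHom.ker F
    simp only [F, d, RingHom.mem_ker, map_sub, AddMonoidAlgebra.mapDomainRingHom_apply,
      AddMonoidAlgebra.mapDomain_single, sub_eq_zero, hψ q hq]
  have hmem : d (a, b) ∈ Ideal.span (↑(P.image d) : Set (AddMonoidAlgebra ℤ (Fin k →₀ ℕ))) := by
    change _ ∈ Submodule.span _ _
    rw [← hspan]
    exact Submodule.subset_span ⟨(a, b), hab, rfl⟩
  have h0 := hle hmem
  simp only [F, d, RingHom.mem_ker, map_sub, AddMonoidAlgebra.mapDomainRingHom_apply,
    AddMonoidAlgebra.mapDomain_single, sub_eq_zero] at h0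
  exact AddMonoidAlgebra.single_left_injective (one_ne_zero) h0

theorem quot_conical (M : Type*) [AddCommMonoid M] : IsConical (mutualLECon M).Quotient := by
  intro x y
  induction x, y using AddCon.induction_on₂ with | _ x y
  intro hxy
  rw [← AddCon.coe_add, ← AddCon.coe_zero, AddCon.eq] at hxy
  rw [← AddCon.coe_zero, AddCon.eq, AddCon.eq]
  exact ⟨⟨(AlgLE.self_add _ _).trans' hxy.1, ⟨x, zero_add x⟩⟩,
    ⟨AlgLE.trans' ⟨x, add_comm _ _⟩ hxy.1, ⟨y, zero_add y⟩⟩⟩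

theorem quot_refinement (M : Type*) [AddCommMonoid M] (htame : IsTame M) :
    IsRefinementAddMonoid (mutualLECon M).Quotient := by
  intro x1 x2 y1 y2
  induction x1, x2 using AddCon.induction_on₂ with | _ x1 x2
  induction y1, y2 using AddCon.induction_on₂ with | _ y1 y2
  intro hxy
  rw [← AddCon.coe_add, ← AddCon.coe_add, AddCon.eq] at hxy
  obtain ⟨⟨u, hu⟩, ⟨v, hv⟩⟩ := hxy
  obtain ⟨W⟩ := htame (AddSubmonoid.closure {x1, x2, y1, y2, u, v})
    ((AddSubmonoid.fg_iff _).2 ⟨_, rfl, by simp⟩)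
  obtain ⟨N, fg, ref, f, g, hfac⟩ := W
  have hm : ∀ z ∈ ({x1, x2, y1, y2, u, v} : Set M),
      z ∈ AddSubmonoid.closure ({x1, x2, y1, y2, u, v} : Set M) :=
    fun z hz => AddSubmonoid.subset_closure hz
  generalize AddSubmonoid.closure ({x1, x2, y1, y2, u, v} : Set M) = S at *
  lift x1 to S using hm _ (by simp)
  lift x2 to S using hm _ (by simp)
  lift y1 to S using hm _ (by simp)
  lift y2 to S using hm _ (by simp)
  lift u to S using hm _ (by simp)
  lift v to S using hm _ (by simp)
  have hu' : x1 + x2 + u = y1 + y2 := by exact_mod_cast hu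
  have hv' : y1 + y2 + v = x1 + x2 := by exact_mod_cast hv
  have key : mutualLECon N (f x1 + f x2) (f y1 + f y2) :=
    ⟨⟨f u, by simp only [← map_add, hu']⟩, ⟨f v, by simp only [← map_add, hv']⟩⟩
  obtain ⟨a, b, c, d, h1, h2, h3, h4⟩ := fg_refine fg ref _ _ _ _ key
  refine ⟨g a, g b, g c, g d, ?_, ?_, ?_, ?_⟩
  · rw [← AddCon.coe_add, AddCon.eq, ← hfac x1, ← map_add]
    exact ⟨h1.1.map' g, h1.2.map' g⟩
  · rw [← AddCon.coe_add, AddCon.eq, ← hfac x2, ← map_add]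
    exact ⟨h2.1.map' g, h2.2.map' g⟩
  · rw [← AddCon.coe_add, ← map_add, ← h3, hfac]
  · rw [← AddCon.coe_add, ← map_add, ← h4, hfac]

theorem quot_tame (M : Type*) [AddCommMonoid M] (htame : IsTame M) :
    IsTame (mutualLECon M).Quotient := by
  classical
  intro S hS
  have : Module.Finite ℕ S :=
    Module.Finite.iff_addMonoid_fg.2 ((AddMonoid.fg_iff_addSubmonoid_fg S).2 hS)
  obtain ⟨k, φ0, hφ0⟩ := Module.Finite.exists_fin' ℕ S
  obtain ⟨φ, hφ⟩ : ∃ φ : (Fin k →₀ ℕ) →+ S, Function.Surjective φ :=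
    ⟨(φ0.comp (Finsupp.linearEquivFunOnFinite ℕ ℕ (Fin k)).toLinearMap).toAddMonoidHom,
      hφ0.comp (Finsupp.linearEquivFunOnFinite ℕ ℕ (Fin k)).surjective⟩
  choose x hx using fun i : Fin k =>
    AddCon.mk'_surjective (c := mutualLECon M) (φ (Finsupp.single i 1) : (mutualLECon M).Quotient)
  let X : (Fin k →₀ ℕ) →+ M := Finsupp.liftAddHom (fun i => multiplesHom M (x i))
  have hX : ∀ a, ((X a : M) : (mutualLECon M).Quotient) = φ a := by
    have : (mutualLECon M).mk'.comp X = S.subtype.comp φ := by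
      ext i
      simp [X, ← hx]
    exact fun a => DFunLike.congr_fun this a
  obtain ⟨P, hP, hred⟩ := redei φ
  have hrel : ∀ q : P, mutualLECon M (X q.1.1) (X q.1.2) := by
    intro q
    rw [← AddCon.eq, hX, hX, hP _ q.2]
  choose u hu using fun q => (hrel q).1
  choose v hv using fun q => (hrel q).2
  let S' : AddSubmonoid M :=
    AddMonoidHom.mrange X ⊔ AddSubmonoid.closure (Set.range u ∪ Set.range v)
  have hS' : S'.FG := by
    refine AddSubmonoid.FG.sup ?_ ((AddSubmonoid.fg_iff _).2 ⟨_, rfl,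
      (Set.finite_range u).union (Set.finite_range v)⟩)
    rw [← AddMonoid.fg_iff_addSubmonoid_fg]
    have : AddMonoid.FG (Fin k →₀ ℕ) := Module.Finite.iff_addMonoid_fg.1 inferInstance
    exact AddMonoid.fg_of_surjective X.mrangeRestrict X.mrangeRestrict_surjective
  obtain ⟨N, fg, ref, f, g, hfac⟩ := (htame S' hS').some
  have hXm : ∀ a, X a ∈ S' := fun a => AddSubmonoid.mem_sup_left ⟨a, rfl⟩
  have hum : ∀ q, u q ∈ S' := fun q =>
    AddSubmonoid.mem_sup_right (AddSubmonoid.subset_closure (Or.inl ⟨q, rfl⟩))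
  have hvm : ∀ q, v q ∈ S' := fun q =>
    AddSubmonoid.mem_sup_right (AddSubmonoid.subset_closure (Or.inr ⟨q, rfl⟩))
  let X' : (Fin k →₀ ℕ) →+ S' := X.codRestrict S' hXm
  let ψ : (Fin k →₀ ℕ) →+ (mutualLECon N).Quotient := (mutualLECon N).mk'.comp (f.comp X')
  have hψ : ∀ q ∈ P, ψ q.1 = ψ q.2 := by
    intro q hq
    refine (AddCon.eq _).2 ⟨⟨f ⟨u ⟨q, hq⟩, hum _⟩, ?_⟩, ⟨f ⟨v ⟨q, hq⟩, hvm _⟩, ?_⟩⟩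
    · change f (X' q.1) + _ = f (X' q.2)
      rw [← map_add]
      exact congrArg f (Subtype.ext (hu ⟨q, hq⟩))
    · change f (X' q.2) + _ = f (X' q.1)
      rw [← map_add]
      exact congrArg f (Subtype.ext (hv ⟨q, hq⟩))
  have hker := hred _ ψ hψ
  choose s hs using hφ
  let F : S →+ (mutualLECon N).Quotient :=
    { toFun := fun y => ψ (s y)
      map_zero' := by
        rw [← map_zero ψ]
        exact hker _ _ (by rw [hs, map_zero])
      map_add' := fun y z => by
        rw [← map_add ψ]
        exact hker _ _ (by rw [map_add, hs, hs, hs]) }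
  have := fg
  refine ⟨⟨(mutualLECon N).Quotient, AddMonoid.fg_of_surjective (mutualLECon N).mk'
    AddCon.mk'_surjective, fg_quot_refinement fg ref, F, quotMap g, ?_⟩⟩
  intro y
  change ((g (f (X' (s y))) : M) : (mutualLECon M).Quotient) = y
  rw [hfac]
  change ((X (s y) : M) : (mutualLECon M).Quotient) = y
  rw [hX, hs]

/-- The maximal antisymmetric quotient of a tame refinement monoid is a conical tame
refinement monoid. -/
theorem maximal_antisymmetric_quotient_tame
    (M : Type*) [AddCommMonoid M] (href : IsRefinementAddMonoid M) (htame : IsTame M) :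
    IsConical (mutualLECon M).Quotient ∧
    IsRefinementAddMonoid (mutualLECon M).Quotient ∧
    IsTame (mutualLECon M).Quotient :=
  ⟨quot_conical M, quot_refinement M htame, quot_tame M htame⟩
end

section
/- Let M be a tame refinement monoid. If M is stably finite, then M is cancellative. -/
theorem fg_wqo_aux (N : Type) [AddCommMonoid N] (hfg : AddMonoid.FG N) (x : ℕ → N) :
    ∃ m n, m < n ∧ ∃ t, x n = x m + t := by
  classical
  obtain ⟨s, hs⟩ := hfg.fg_top
  have h : ∀ n, ∃ f : s → ℕ, ∑ a : s, f a • (a : N) = x n := by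
    intro n
    have : x n ∈ AddSubmonoid.closure (s : Set N) := by rw [hs]; trivial
    obtain ⟨f, _, hf⟩ := AddSubmonoid.mem_closure_finset.1 this
    refine ⟨fun a => f a, ?_⟩
    rw [← hf]
    exact Finset.sum_coe_sort s (fun a => f a • a)
  choose f hf using h
  obtain ⟨m, n, hmn, hle⟩ := wellQuasiOrdered_le f
  refine ⟨m, n, hmn, ∑ a : s, (f n a - f m a) • (a : N), ?_⟩
  rw [← hf, ← hf, ← Finset.sum_add_distrib]
  refine Finset.sum_congr rfl fun a _ => ?_
  rw [← add_smul, Nat.add_sub_cancel' (hle a)]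

/-- A stably finite tame refinement monoid is cancellative. -/
theorem tame_stablyFinite_cancellative
    (M : Type*) [AddCommMonoid M] (href : IsRefinementAddMonoid M) (htame : IsTame M)
    (hsf : IsStablyFinite M) : IsCancellative M := by
  classical
  intro x y z hxyz
  let S : AddSubmonoid M := AddSubmonoid.closure (({x, y, z} : Finset M) : Set M)
  have hx : x ∈ S := AddSubmonoid.subset_closure (by simp)
  have hy : y ∈ S := AddSubmonoid.subset_closure (by simp)
  have hz : z ∈ S := AddSubmonoid.subset_closure (by simp)
  obtain ⟨W⟩ := htame S ⟨_, rfl⟩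
  obtain ⟨N, fg, ref, f, g, hfac⟩ := W
  let T := {p : N × N × N // p.1 + p.2.1 = p.1 + p.2.2}
  let R : T → T → Prop := fun s t => ∃ Y Z E, s.1.1 = t.1.1 + t.1.2.1 + Y ∧
    s.1.1 = t.1.1 + t.1.2.2 + Z ∧ s.1.2.1 = t.1.2.1 + E ∧ s.1.2.2 = t.1.2.2 + E
  have hstep : ∀ s : T, ∃ t : T, R s t := by
    rintro ⟨⟨a, b, c⟩, h⟩
    obtain ⟨p, q, r, e, h1, h2, h3, h4⟩ := ref _ _ _ _ h
    refine ⟨⟨⟨p, r, q⟩, by simpa using h3.symm.trans h1⟩, 0, 0, e, ?_, ?_, h2, h4⟩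
    · simpa using h3
    · simpa using h1
  choose nx hnx using hstep
  have htr : IsTrans T R := ⟨by
    rintro s t u ⟨Y, Z, E, h1, h2, h3, h4⟩ ⟨Y', Z', E', h1', h2', h3', h4'⟩
    refine ⟨Y' + t.1.2.1 + Y, Z' + t.1.2.2 + Z, E' + E, ?_, ?_, ?_, ?_⟩
    · rw [h1]; nth_rw 1 [h1']; abel
    · rw [h2]; nth_rw 1 [h2']; abel
    · rw [h3, h3']; abel
    · rw [h4, h4']; abel⟩
  let s0 : T := ⟨⟨f ⟨x, hx⟩, f ⟨y, hy⟩, f ⟨z, hz⟩⟩, by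
    change f _ + f _ = f _ + f _
    rw [← map_add, ← map_add]; congr 1; exact Subtype.ext hxyz⟩
  let s : ℕ → T := fun n => nx^[n] s0
  have hs : ∀ n, R (s n) (s (n+1)) := by
    intro n
    simp only [s, Function.iterate_succ_apply']
    exact hnx _
  have hlt : ∀ {m n}, m < n → R (s m) (s n) := fun h => Nat.rel_of_forall_rel_succ_of_lt R hs h
  obtain ⟨m, n, hmn, t, ht⟩ := fg_wqo_aux N fg (fun n => (s n).1.1)
  obtain ⟨Y, Z, -, h1, h2, -, -⟩ := hlt hmn
  obtain ⟨-, -, E, -, -, h3, h4⟩ := hlt (lt_of_le_of_lt (Nat.zero_le m) hmn)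
  have hsn := (s n).2
  have h3 : f ⟨y, hy⟩ = (s n).1.2.1 + E := h3
  have h4 : f ⟨z, hz⟩ = (s n).1.2.2 + E := h4
  have ey := hfac ⟨y, hy⟩
  have ez := hfac ⟨z, hz⟩
  rw [h3, map_add] at ey
  rw [h4, map_add] at ez
  generalize (s n).1.1 = a at *
  generalize (s n).1.2.1 = b at *
  generalize (s n).1.2.2 = c at *
  simp only at ey ez ht
  rw [← ey, ← ez]
  have hb : g c + (g Z + g t) = 0 := by
    apply hsf (g a)
    rw [← map_add, ← map_add, ← map_add]
    congr 1
    conv_rhs => rw [ht, h2]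
    abel
  have hbc : g a + g b = g a + g c := by rw [← map_add, hsn, map_add]
  have h0 : g b + (g Z + g t) = 0 := by
    apply hsf (g a)
    rw [← add_assoc, hbc, add_assoc, hb, add_zero]
  have : g b = g c := by
    calc g b = g b + (g c + (g Z + g t)) := by rw [hb, add_zero]
      _ = g c + (g b + (g Z + g t)) := by abel
      _ = g c := by rw [h0, add_zero]
  rw [this]
end

section
/- Let M be a tame refinement monoid, and set J := { a ∈ M | there exists b ∈ M with a + b ≤ b }. Then J is an o-ideal of M, and the quotient monoid M/J is a cancellative tame refinement monoid. -/
/-- The submonoid `J = { a ∈ M | a + b ≤ b for some b }`. -/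
def wedgeIdeal (M : Type*) [AddCommMonoid M] : AddSubmonoid M where
  carrier := {a : M | ∃ b : M, AlgLE (a + b) b}
  zero_mem' := ⟨0, 0, by simp⟩
  add_mem' := by
    rintro a a' ⟨b, z, hz⟩ ⟨b', z', hz'⟩
    refine ⟨b + b', z + z', ?_⟩
    calc a + a' + (b + b') + (z + z') = (a + b + z) + (a' + b' + z') := by abel
      _ = b + b' := by rw [hz, hz']

namespace WedgeAux

theorem ideal_down {M : Type*} [AddCommMonoid M] {x y : M} (hy : y ∈ wedgeIdeal M)
    (h : AlgLE x y) : x ∈ wedgeIdeal M := by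
  obtain ⟨b, z, hz⟩ := hy
  obtain ⟨c, rfl⟩ := h
  exact ⟨b, c + z, (by abel : x + b + (c + z) = x + c + b + z).trans hz⟩

theorem mem_of_eq {M : Type*} [AddCommMonoid M] {a b c : M} (h : a + b + c = b) :
    a ∈ wedgeIdeal M := ⟨b, c, h⟩

theorem exists_of_mem {M : Type*} [AddCommMonoid M] {a : M} (h : a ∈ wedgeIdeal M) :
    ∃ b c, a + b + c = b := h

theorem map_mem {M N : Type*} [AddCommMonoid M] [AddCommMonoid N] (g : N →+ M) {a : N}
    (h : a ∈ wedgeIdeal N) : g a ∈ wedgeIdeal M := by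
  obtain ⟨b, c, h⟩ := exists_of_mem h
  exact mem_of_eq (b := g b) (c := g c) (by rw [← map_add, ← map_add, h])

abbrev Q (M : Type*) [AddCommMonoid M] := (oIdealCon (wedgeIdeal M)).Quotient

def mk (M : Type*) [AddCommMonoid M] : M →+ Q M := (oIdealCon (wedgeIdeal M)).mk'

theorem mk_surj (M : Type*) [AddCommMonoid M] : Function.Surjective (mk M) :=
  AddCon.mk'_surjective

theorem mk_eq {M : Type*} [AddCommMonoid M] {x y : M} :
    mk M x = mk M y ↔ ∃ a ∈ wedgeIdeal M, ∃ b ∈ wedgeIdeal M, x + a = y + b :=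
  AddCon.eq (oIdealCon (wedgeIdeal M))

theorem mk_zero {M : Type*} [AddCommMonoid M] {x : M} (h : x ∈ wedgeIdeal M) :
    mk M x = 0 := by
  rw [← map_zero (mk M), mk_eq]
  exact ⟨0, zero_mem _, x, h, by simp⟩

theorem Q_stable {M : Type*} [AddCommMonoid M] (a b c : Q M) (h : a + b + c = b) : a = 0 := by
  obtain ⟨a, rfl⟩ := mk_surj M a
  obtain ⟨b, rfl⟩ := mk_surj M b
  obtain ⟨c, rfl⟩ := mk_surj M c
  rw [← map_add, ← map_add, mk_eq] at h
  obtain ⟨j, hj, j', hj', h⟩ := h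
  obtain ⟨d, e, hd⟩ := exists_of_mem hj'
  apply mk_zero
  apply mem_of_eq (b := b + d) (c := c + j + e)
  calc a + (b + d) + (c + j + e) = (a + b + c + j) + (d + e) := by abel
    _ = b + (j' + d + e) := by rw [h]; abel
    _ = b + d := by rw [hd]

theorem Q_refinement {M : Type*} [AddCommMonoid M] (href : IsRefinementAddMonoid M) :
    IsRefinementAddMonoid (Q M) := by
  intro x1 x2 y1 y2 h
  obtain ⟨x1, rfl⟩ := mk_surj M x1
  obtain ⟨x2, rfl⟩ := mk_surj M x2
  obtain ⟨y1, rfl⟩ := mk_surj M y1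
  obtain ⟨y2, rfl⟩ := mk_surj M y2
  rw [← map_add, ← map_add, mk_eq] at h
  obtain ⟨a, ha, b, hb, h⟩ := h
  obtain ⟨p, q, r, s, h1, h2, h3, h4⟩ := href _ _ _ _ h
  -- x1 + x2 = p + q, a = r + s, y1 + y2 = p + r, b = q + s
  obtain ⟨p1, q1, p2, q2, e1, e2, e3, e4⟩ := href _ _ _ _ h1
  obtain ⟨u1, u2, v1, v2, f1, f2, f3, f4⟩ := href _ _ _ _ h3
  -- y1 = u1 + u2, y2 = v1 + v2, p = u1 + v1, r = u2 + v2
  obtain ⟨w11, w12, w21, w22, g1, g2, g3, g4⟩ := href _ _ _ _ (e3.symm.trans f3)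
  have hr : r ∈ wedgeIdeal M := ideal_down ha ⟨s, h2.symm⟩
  have hq : q ∈ wedgeIdeal M := ideal_down hb ⟨s, h4.symm⟩
  have hq1 : mk M q1 = 0 := mk_zero (ideal_down hq ⟨q2, e4.symm⟩)
  have hq2 : mk M q2 = 0 := mk_zero (ideal_down hq ⟨q1, by rw [e4, add_comm]⟩)
  have hu2 : mk M u2 = 0 := mk_zero (ideal_down hr ⟨v2, f4.symm⟩)
  have hv2 : mk M v2 = 0 := mk_zero (ideal_down hr ⟨u2, by rw [f4, add_comm]⟩)
  refine ⟨mk M w11, mk M w12, mk M w21, mk M w22, ?_, ?_, ?_, ?_⟩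
  · rw [e1, map_add, hq1, add_zero, g1, map_add]
  · rw [e2, map_add, hq2, add_zero, g2, map_add]
  · rw [f1, map_add, hu2, add_zero, g3, map_add]
  · rw [f2, map_add, hv2, add_zero, g4, map_add]

theorem mem_closure_cases {P : Type*} [AddCommMonoid P] [DecidableEq P] (A : Finset P) (g : P)
    (x : P) (hx : x ∈ AddSubmonoid.closure (A : Set P)) :
    x ∈ AddSubmonoid.closure ((A.erase g : Finset P) : Set P) ∨ ∃ y, x = g + y := by
  induction hx using AddSubmonoid.closure_induction with
  | mem x hx =>
    by_cases h : x = g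
    · exact Or.inr ⟨0, by simp [h]⟩
    · exact Or.inl (AddSubmonoid.subset_closure (by simp [h]; exact hx))
  | zero => exact Or.inl (zero_mem _)
  | add x y _ _ h1 h2 =>
    rcases h1 with h1 | ⟨y1, rfl⟩
    · rcases h2 with h2 | ⟨y2, rfl⟩
      · exact Or.inl (add_mem h1 h2)
      · exact Or.inr ⟨x + y2, by abel⟩
    · exact Or.inr ⟨y1 + y, by abel⟩

theorem cancel_of_fg {P : Type*} [AddCommMonoid P] (hfg : AddMonoid.FG P)
    (href : IsRefinementAddMonoid P) (hst : ∀ a b c : P, a + b + c = b → a = 0) :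
    IsCancellative P := by
  classical
  have hst' : ∀ a b : P, b = b + a → a = 0 := fun a b h =>
    hst a b 0 (by rw [add_zero, add_comm]; exact h.symm)
  have hex : ∃ n, ∃ A : Finset P, A.card = n ∧ AddSubmonoid.closure (A : Set P) = ⊤ := by
    obtain ⟨A, hA⟩ := hfg.1
    exact ⟨_, A, rfl, hA⟩
  obtain ⟨A, hAc, hA⟩ := Nat.find_spec hex
  have hatom : ∀ g ∈ A, ∀ a b, g = a + b → a = 0 ∨ b = 0 := by
    intro g hg a b hab
    have ha := mem_closure_cases A g a (by rw [hA]; trivial)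
    have hb := mem_closure_cases A g b (by rw [hA]; trivial)
    rcases ha with ha | ⟨y, rfl⟩
    · rcases hb with hb | ⟨y, rfl⟩
      · exfalso
        have hlt : (A.erase g).card < Nat.find hex := by
          rw [← hAc]; exact Finset.card_erase_lt_of_mem hg
        refine Nat.find_min hex hlt ⟨_, rfl, ?_⟩
        rw [eq_top_iff, ← hA, AddSubmonoid.closure_le]
        intro x hx
        by_cases h : x = g
        · have hm := add_mem ha hb
          rw [← hab] at hm
          rw [h]; exact hm
        · exact AddSubmonoid.subset_closure (by simp [h]; exact hx)
      · left
        exact hst a g y (by rw [add_assoc]; exact hab.symm)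
    · right
      exact hst b g y (by rw [add_assoc, add_comm b]; exact hab.symm)
  intro x
  have hx : x ∈ AddSubmonoid.closure (A : Set P) := by rw [hA]; trivial
  induction hx using AddSubmonoid.closure_induction with
  | mem p hp =>
    intro y z h
    obtain ⟨a, b, c, d, h1, h2, h3, h4⟩ := href _ _ _ _ h
    rcases hatom p hp a b h1 with rfl | rfl
    · rw [zero_add] at h1 h3
      rw [h2, h4, ← h1, ← h3]
    · rw [add_zero] at h1
      rw [← h1] at h3
      have := hst' _ _ h3
      rw [h2, h4, this]
  | zero => intro y z h; simpa using h
  | add a b _ _ h1 h2 =>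
    intro y z h
    rw [add_assoc, add_assoc] at h
    exact h2 _ _ (h1 _ _ h)

theorem Q_fg {M : Type*} [AddCommMonoid M] (h : AddMonoid.FG M) : AddMonoid.FG (Q M) :=
  AddMonoid.fg_of_surjective (mk M) (mk_surj M)

theorem Q_cancel_fg {M : Type*} [AddCommMonoid M] (h : AddMonoid.FG M)
    (href : IsRefinementAddMonoid M) : IsCancellative (Q M) :=
  cancel_of_fg (Q_fg h) (Q_refinement href) Q_stable

theorem Q_cancel {M : Type*} [AddCommMonoid M] (htame : IsTame M) : IsCancellative (Q M) := by
  classical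
  intro x y z h
  obtain ⟨x, rfl⟩ := mk_surj M x
  obtain ⟨y, rfl⟩ := mk_surj M y
  obtain ⟨z, rfl⟩ := mk_surj M z
  rw [← map_add, ← map_add, mk_eq] at h
  obtain ⟨a, ha, b, hb, h⟩ := h
  have hfin : (AddSubmonoid.closure ((({x, y + a, z + b} : Finset M)) : Set M)).FG := ⟨_, rfl⟩
  have hsub : ∀ t ∈ ({x, y + a, z + b} : Finset M),
    t ∈ AddSubmonoid.closure ((({x, y + a, z + b} : Finset M)) : Set M) :=
    fun t ht => AddSubmonoid.subset_closure ht
  generalize AddSubmonoid.closure ((({x, y + a, z + b} : Finset M)) : Set M) = S at hfin hsub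
  obtain ⟨w⟩ := htame S hfin
  let _ := w.instN
  have hc := Q_cancel_fg w.fg w.refinement
  let X : S := ⟨x, hsub _ (by simp)⟩
  let Y : S := ⟨y + a, hsub _ (by simp)⟩
  let Z : S := ⟨z + b, hsub _ (by simp)⟩
  have hXYZ : X + Y = X + Z := Subtype.ext (by
    show x + (y + a) = x + (z + b)
    rw [← add_assoc, h, add_assoc])
  have h1 : mk w.N (w.f Y) = mk w.N (w.f Z) := by
    apply hc (mk w.N (w.f X))
    rw [← map_add, ← map_add, hXYZ, map_add, map_add]
  rw [mk_eq] at h1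
  obtain ⟨p, hp, q, hq, h1⟩ := h1
  have h2 := congrArg w.g h1
  rw [map_add, map_add, w.factors, w.factors] at h2
  rw [mk_eq]
  refine ⟨a + w.g p, add_mem ha (map_mem _ hp), b + w.g q, add_mem hb (map_mem _ hq), ?_⟩
  rw [← add_assoc, ← add_assoc]
  exact h2

noncomputable def toZ (T : Type*) : (T →₀ ℕ) →+ (T →₀ ℤ) :=
  Finsupp.mapRange.addMonoidHom (Nat.castAddMonoidHom ℤ)

theorem toZ_inj (T : Type*) : Function.Injective (toZ T) := by
  intro u v h
  ext t
  have := DFunLike.congr_fun h t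
  simpa [toZ] using this

noncomputable def diffSub {T P : Type*} [AddCommMonoid P] (h : (T →₀ ℕ) →+ P) : AddSubgroup (T →₀ ℤ) where
  carrier := {w | ∃ u v, h u = h v ∧ w = toZ T u - toZ T v}
  zero_mem' := ⟨0, 0, rfl, by simp⟩
  add_mem' := by
    rintro _ _ ⟨u, v, e, rfl⟩ ⟨u', v', e', rfl⟩
    exact ⟨u + u', v + v', by simp [e, e'], by simp only [map_add]; abel⟩
  neg_mem' := by
    rintro _ ⟨u, v, e, rfl⟩
    exact ⟨v, u, e.symm, by abel⟩

theorem diffSub_mem {T P : Type*} [AddCommMonoid P] (hP : IsCancellative P)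
    (h : (T →₀ ℕ) →+ P) (u v : T →₀ ℕ) (hw : toZ T u - toZ T v ∈ diffSub h) : h u = h v := by
  obtain ⟨u', v', e, hw⟩ := hw
  have : u + v' = v + u' := by
    apply toZ_inj
    rw [map_add, map_add, add_comm (toZ T v)]
    exact sub_eq_sub_iff_add_eq_add.1 hw
  apply hP (h v')
  rw [add_comm, ← map_add, this, map_add, e, add_comm]

theorem diffSub_fg {T P : Type*} [Finite T] [AddCommMonoid P] (h : (T →₀ ℕ) →+ P) :
    (diffSub h).FG := by
  have := IsNoetherian.noetherian (AddSubgroup.toIntSubmodule (diffSub h))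
  rw [Submodule.fg_iff_addSubgroup_fg] at this
  exact this

theorem Q_tame {M : Type*} [AddCommMonoid M] (htame : IsTame M) : IsTame (Q M) := by
  classical
  rintro S ⟨T, hT⟩
  choose l hl using mk_surj M
  let Λ : (T →₀ ℕ) →+ M := Finsupp.liftAddHom (fun t => multiplesHom M (l t.1))
  let ψ : (T →₀ ℕ) →+ Q M := (mk M).comp Λ
  have hψS : ∀ s ∈ S, ∃ u, ψ u = s := by
    intro s hs
    have : S ≤ AddMonoidHom.mrange ψ := by
      rw [← hT, AddSubmonoid.closure_le]
      intro t ht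
      refine ⟨Finsupp.single ⟨t, ht⟩ 1, ?_⟩
      simp [ψ, Λ, hl]
    exact this hs
  obtain ⟨W, hW⟩ := diffSub_fg ψ
  have hWmem : ∀ w ∈ W, ∃ u v, ∃ a b d e d' e', w = toZ T u - toZ T v ∧
      Λ u + a = Λ v + b ∧ a + d + e = d ∧ b + d' + e' = d' := by
    intro w hw
    have : w ∈ diffSub ψ := by rw [← hW]; exact AddSubgroup.subset_closure hw
    obtain ⟨u, v, h, rfl⟩ := this
    obtain ⟨a, ha, b, hb, h⟩ := mk_eq.1 h
    obtain ⟨d, e, h1⟩ := exists_of_mem ha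
    obtain ⟨d', e', h2⟩ := exists_of_mem hb
    exact ⟨u, v, a, b, d, e, d', e', rfl, h, h1, h2⟩
  choose! u v a b d e d' e' h0 h1 h2 h3 using hWmem
  let G : Finset M := T.image l ∪ W.biUnion (fun w => {a w, b w, d w, e w, d' w, e' w})
  have hfin : (AddSubmonoid.closure (G : Set M)).FG := ⟨_, rfl⟩
  have hsub : ∀ t ∈ G, t ∈ AddSubmonoid.closure (G : Set M) :=
    fun t ht => AddSubmonoid.subset_closure ht
  generalize AddSubmonoid.closure (G : Set M) = S' at hfin hsub
  have hlS : ∀ t : T, l t.1 ∈ S' := fun t => hsub _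
    (Finset.mem_union_left _ (Finset.mem_image_of_mem _ t.2))
  have hwS : ∀ w ∈ W, ∀ x ∈ ({a w, b w, d w, e w, d' w, e' w} : Finset M), x ∈ S' :=
    fun w hw x hx => hsub _ (Finset.mem_union_right _ (Finset.mem_biUnion.2 ⟨w, hw, hx⟩))
  obtain ⟨ω⟩ := htame S' hfin
  let _ := ω.instN
  have hc := Q_cancel_fg ω.fg ω.refinement
  let Λ' : (T →₀ ℕ) →+ S' :=
    Finsupp.liftAddHom (fun t => multiplesHom S' (⟨l t.1, hlS t⟩ : S'))
  have hΛ : ∀ x, (Λ' x : M) = Λ x := by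
    have : S'.subtype.comp Λ' = Λ := by
      ext t
      simp [Λ, Λ']
    exact fun x => DFunLike.congr_fun this x
  let h : (T →₀ ℕ) →+ Q ω.N := ((mk ω.N).comp ω.f).comp Λ'
  have hle : diffSub ψ ≤ diffSub h := by
    rw [← hW, AddSubgroup.closure_le]
    intro w hw
    refine ⟨u w, v w, ?_, h0 w hw⟩
    let A : S' := ⟨a w, hwS w hw _ (by simp)⟩
    let B : S' := ⟨b w, hwS w hw _ (by simp)⟩
    let D : S' := ⟨d w, hwS w hw _ (by simp)⟩
    let E : S' := ⟨e w, hwS w hw _ (by simp)⟩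
    let D' : S' := ⟨d' w, hwS w hw _ (by simp)⟩
    let E' : S' := ⟨e' w, hwS w hw _ (by simp)⟩
    have k1 : A ∈ wedgeIdeal S' := mem_of_eq (b := D) (c := E) (Subtype.ext (h2 w hw))
    have k2 : B ∈ wedgeIdeal S' := mem_of_eq (b := D') (c := E') (Subtype.ext (h3 w hw))
    have k3 : Λ' (u w) + A = Λ' (v w) + B := Subtype.ext (by
      show (Λ' (u w) : M) + a w = (Λ' (v w) : M) + b w
      rw [hΛ, hΛ]; exact h1 w hw)
    exact mk_eq.2 ⟨ω.f A, map_mem _ k1, ω.f B, map_mem _ k2, by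
      rw [← map_add, ← map_add, k3]⟩
  have hker : ∀ x y, ψ x = ψ y → h x = h y := fun x y hxy =>
    diffSub_mem hc h x y (hle ⟨x, y, hxy, rfl⟩)
  let g' : Q ω.N →+ Q M := AddCon.lift (oIdealCon (wedgeIdeal ω.N)) ((mk M).comp ω.g) (by
    rintro x y ⟨p, hp, q, hq, hpq⟩
    refine mk_eq.2 ⟨ω.g p, map_mem _ hp, ω.g q, map_mem _ hq, ?_⟩
    rw [← map_add, hpq, map_add])
  have hg' : ∀ n, g' (mk ω.N n) = mk M (ω.g n) := fun n => rfl
  have hg'h : ∀ x, g' (h x) = ψ x := by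
    intro x
    show g' (mk ω.N (ω.f (Λ' x))) = mk M (Λ x)
    rw [hg', ω.factors, hΛ]
  choose c hcS using fun s : S => hψS s.1 s.2
  exact ⟨{ N := Q ω.N
           fg := Q_fg ω.fg
           refinement := Q_refinement ω.refinement
           f := { toFun := fun s => h (c s)
                  map_zero' := by
                    rw [← map_zero h]; apply hker; rw [hcS, map_zero]; rfl
                  map_add' := fun s t => by
                    rw [← map_add h]; apply hker; rw [map_add, hcS, hcS, hcS]; rfl }
           g := g'
           factors := fun s => (hg'h _).trans (hcS s) }⟩

end WedgeAux

/-- For a tame refinement monoid `M`, the set `J = { a | ∃ b, a + b ≤ b }` is an o-ideal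
of `M`, and `M/J` is a cancellative tame refinement monoid. -/
theorem wedgeIdeal_quotient_cancellative_tame
    (M : Type*) [AddCommMonoid M] (href : IsRefinementAddMonoid M) (htame : IsTame M) :
    ((∀ a : M, a ∈ wedgeIdeal M ↔ ∃ b : M, AlgLE (a + b) b) ∧
      ∀ x y : M, y ∈ wedgeIdeal M → AlgLE x y → x ∈ wedgeIdeal M) ∧
    (IsCancellative (oIdealCon (wedgeIdeal M)).Quotient ∧
      IsRefinementAddMonoid (oIdealCon (wedgeIdeal M)).Quotient ∧
      IsTame (oIdealCon (wedgeIdeal M)).Quotient) := by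
  exact ⟨⟨fun a => Iff.rfl, fun x y hy h => WedgeAux.ideal_down hy h⟩,
    WedgeAux.Q_cancel htame, WedgeAux.Q_refinement href, WedgeAux.Q_tame htame⟩
end

section
/- Let M be a stably finite conical refinement monoid. Then M is tame if and only if it is unperforated and cancellative. -/
section partA

def AtomLike {N : Type*} [AddCommMonoid N] (p : N) : Prop :=
  ∀ a b : N, p = a + b → a = 0 ∨ b = 0

theorem exists_atoms {N : Type*} [AddCommMonoid N] (hfg : AddMonoid.FG N)
    (hsf : IsStablyFinite N) (hcon : IsConical N) :
    ∃ S : Finset N, AddSubmonoid.closure (S : Set N) = ⊤ ∧ ∀ p ∈ S, AtomLike p := by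
  classical
  obtain ⟨S0, hS0⟩ := hfg.fg_top
  have hex : ∃ n, ∃ S : Finset N, S.card = n ∧ AddSubmonoid.closure (S : Set N) = ⊤ :=
    ⟨_, S0, rfl, hS0⟩
  obtain ⟨S, hSc, hS⟩ := Nat.find_spec hex
  refine ⟨S, hS, fun p hp a b hab => ?_⟩
  have key : ∀ a : N, a ∈ AddSubmonoid.closure ((S.erase p : Finset N) : Set N) ∨
      ∃ a', a = p + a' := by
    intro a
    have ha : a ∈ AddSubmonoid.closure (S : Set N) := by rw [hS]; trivial
    induction ha using AddSubmonoid.closure_induction with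
    | mem x hx =>
      by_cases h : x = p
      · exact Or.inr ⟨0, by simp [h]⟩
      · exact Or.inl (AddSubmonoid.subset_closure (by simpa [h] using hx))
    | zero => exact Or.inl (zero_mem _)
    | add x y _ _ hx hy =>
      rcases hx with hx | ⟨x', rfl⟩
      · rcases hy with hy | ⟨y', rfl⟩
        · exact Or.inl (add_mem hx hy)
        · exact Or.inr ⟨x + y', by abel⟩
      · exact Or.inr ⟨x' + y, by abel⟩
  rcases key a with ha | ⟨a', rfl⟩
  · rcases key b with hb | ⟨b', rfl⟩
    · exfalso
      have hpm : p ∈ AddSubmonoid.closure ((S.erase p : Finset N) : Set N) := by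
        have := add_mem ha hb
        rwa [← hab] at this
      have htop : AddSubmonoid.closure ((S.erase p : Finset N) : Set N) = ⊤ := by
        rw [eq_top_iff, ← hS, AddSubmonoid.closure_le]
        intro x hx
        by_cases h : x = p
        · rw [h]; exact hpm
        · exact AddSubmonoid.subset_closure (by simpa [h] using hx)
      have := Nat.find_min' hex ⟨S.erase p, rfl, htop⟩
      have h2 := Finset.card_erase_lt_of_mem hp
      omega
    · left
      have : p + (b' + a) = p := by
        conv_rhs => rw [hab]
        abel
      exact (hcon _ _ (hsf _ _ this)).2
  · right
    have : p + (a' + b) = p := by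
      conv_rhs => rw [hab]
      abel
    exact (hcon _ _ (hsf _ _ this)).2

theorem atom_cancel {N : Type*} [AddCommMonoid N] (href : IsRefinementAddMonoid N)
    (hsf : IsStablyFinite N) {p : N} (hp : AtomLike p) (a b : N)
    (h : p + a = p + b) : a = b := by
  obtain ⟨z1, z2, z3, z4, h1, h2, h3, h4⟩ := href _ _ _ _ h
  rcases hp _ _ h1 with h0 | h0
  · subst h0
    simp only [zero_add] at h1 h3
    rw [h2, h4, ← h1, ← h3]
  · subst h0
    simp only [zero_add, add_zero] at h1 h4
    subst h1
    have := hsf _ _ h3.symm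
    rw [h2, h4, this, zero_add]

theorem atom_prime {N : Type*} [AddCommMonoid N] (href : IsRefinementAddMonoid N)
    {p : N} (hp : AtomLike p) (a b : N)
    (h : AlgLE p (a + b)) : AlgLE p a ∨ AlgLE p b := by
  obtain ⟨z, hz⟩ := h
  obtain ⟨z1, z2, z3, z4, h1, h2, h3, h4⟩ := href _ _ _ _ hz
  rcases hp _ _ h1 with h0 | h0
  · right; exact ⟨z4, by rw [h4, h1, h0, zero_add]⟩
  · left; exact ⟨z3, by rw [h3, h1, h0, add_zero]⟩

theorem atom_prime_nsmul {N : Type*} [AddCommMonoid N] (href : IsRefinementAddMonoid N)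
    {p : N} (hp : AtomLike p) (y : N) (m : ℕ)
    (h : AlgLE p ((m + 1) • y)) : AlgLE p y := by
  induction m with
  | zero => simpa using h
  | succ k ih =>
    rw [succ_nsmul] at h
    rcases atom_prime href hp _ _ h with h | h
    · exact ih h
    · exact h

theorem fg_canc {N : Type*} [AddCommMonoid N] (hfg : AddMonoid.FG N)
    (href : IsRefinementAddMonoid N)
    (hsf : IsStablyFinite N) (hcon : IsConical N) : IsUnperforated N ∧ IsCancellative N := by
  obtain ⟨S, hS, hat⟩ := exists_atoms hfg hsf hcon
  have hmem : ∀ x : N, x ∈ AddSubmonoid.closure (S : Set N) := by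
    intro x; rw [hS]; trivial
  have hc : IsCancellative N := by
    intro x
    induction hmem x using AddSubmonoid.closure_induction with
    | mem x hx => exact fun a b h => atom_cancel href hsf (hat x hx) a b h
    | zero => intro a b h; simpa using h
    | add x y _ _ hx hy =>
      intro a b h
      rw [add_assoc, add_assoc] at h
      exact hy _ _ (hx _ _ h)
  refine ⟨?_, hc⟩
  intro m x y hm
  obtain ⟨m, rfl⟩ : ∃ k, m = k + 1 := ⟨m - 1, by omega⟩
  induction hmem x using AddSubmonoid.closure_induction_left generalizing y with
  | zero => exact fun _ => ⟨y, zero_add y⟩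
  | add_left p hp x _ ih =>
    intro h
    have h1 : AlgLE p ((m + 1) • y) := by
      obtain ⟨z, hz⟩ := h
      refine ⟨m • p + (m + 1) • x + z, ?_⟩
      rw [← hz, nsmul_add, succ_nsmul p]; abel
    obtain ⟨y', rfl⟩ := atom_prime_nsmul href (hat p hp) _ _ h1
    obtain ⟨z, hz⟩ := h
    rw [nsmul_add, nsmul_add, add_assoc] at hz
    obtain ⟨w, rfl⟩ := ih y' ⟨z, hc _ _ _ hz⟩
    exact ⟨w, by abel⟩

def kerCon {N M : Type*} [AddCommMonoid N] [AddCommMonoid M] (g : N →+ M) : AddCon N where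
  r x y := ∃ i j, g i = 0 ∧ g j = 0 ∧ x + i = y + j
  iseqv :=
    { refl := fun x => ⟨0, 0, by simp, by simp, rfl⟩
      symm := fun ⟨i, j, hi, hj, h⟩ => ⟨j, i, hj, hi, h.symm⟩
      trans := by
        rintro x y z ⟨i, j, hi, hj, h⟩ ⟨i', j', hi', hj', h'⟩
        refine ⟨i + i', j' + j, by simp [*], by simp [*], ?_⟩
        rw [← add_assoc, h, ← add_assoc, ← h']; abel }
  add' := by
    rintro w x y z ⟨i, j, hi, hj, h⟩ ⟨i', j', hi', hj', h'⟩
    refine ⟨i + i', j + j', by simp [*], by simp [*], ?_⟩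
    rw [add_add_add_comm, h, h']; abel

theorem kerCon_iff {N M : Type*} [AddCommMonoid N] [AddCommMonoid M] (g : N →+ M) (x y : N) :
    ((x : (kerCon g).Quotient) = y) ↔ ∃ i j, g i = 0 ∧ g j = 0 ∧ x + i = y + j :=
  (kerCon g).eq

theorem quot_facts {N M : Type*} [AddCommMonoid N] [AddCommMonoid M] (g : N →+ M)
    (hfg : AddMonoid.FG N) (href : IsRefinementAddMonoid N)
    (hsf : IsStablyFinite M) (hcon : IsConical M) :
    IsUnperforated (kerCon g).Quotient ∧ IsCancellative (kerCon g).Quotient := by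
  have hz : ∀ x : N, g x = 0 → (x : (kerCon g).Quotient) = 0 := by
    intro x hx
    rw [← AddCon.coe_zero, kerCon_iff]
    exact ⟨0, x, by simp, hx, by simp⟩
  apply fg_canc
  · haveI := hfg
    exact AddMonoid.fg_of_surjective (kerCon g).mk' AddCon.mk'_surjective
  · intro x1 x2 y1 y2 h
    induction x1 using AddCon.induction_on with | _ x1 => ?_
    induction x2 using AddCon.induction_on with | _ x2 => ?_
    induction y1 using AddCon.induction_on with | _ y1 => ?_
    induction y2 using AddCon.induction_on with | _ y2 => ?_
    rw [← AddCon.coe_add, ← AddCon.coe_add, kerCon_iff] at h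
    obtain ⟨i, j, hi, hj, h⟩ := h
    rw [add_assoc, add_assoc] at h
    obtain ⟨z11, z12, z21, z22, h1, h2, h3, h4⟩ := href _ _ _ _ h
    have e2 : (x2 : (kerCon g).Quotient) = z21 + z22 := by
      rw [← AddCon.coe_add, ← h2, AddCon.coe_add, hz i hi, add_zero]
    have e4 : (y2 : (kerCon g).Quotient) = z12 + z22 := by
      rw [← AddCon.coe_add, ← h4, AddCon.coe_add, hz j hj, add_zero]
    exact ⟨z11, z12, z21, z22, by rw [h1]; rfl, e2, by rw [h3]; rfl, e4⟩
  · intro x y h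
    induction x using AddCon.induction_on with | _ x => ?_
    induction y using AddCon.induction_on with | _ y => ?_
    rw [← AddCon.coe_add, kerCon_iff] at h
    obtain ⟨i, j, hi, hj, h⟩ := h
    apply hz
    have := congrArg g h
    simp only [map_add, hi, hj, add_zero] at this
    exact hsf _ _ this
  · intro x y h
    induction x using AddCon.induction_on with | _ x => ?_
    induction y using AddCon.induction_on with | _ y => ?_
    rw [← AddCon.coe_add, ← AddCon.coe_zero, kerCon_iff] at h
    obtain ⟨i, j, hi, hj, h⟩ := h
    have := congrArg g h
    simp only [map_add, hi, hj, add_zero, map_zero] at this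
    obtain ⟨ha, hb⟩ := hcon _ _ this
    exact ⟨hz _ ha, hz _ hb⟩

theorem witness_facts {M : Type*} [AddCommMonoid M] (htame : IsTame M)
    (hsf : IsStablyFinite M) (hcon : IsConical M) (T : Finset M) :
    ∃ (Q : Type) (_ : AddCommMonoid Q) (f : AddSubmonoid.closure (T : Set M) →+ Q) (g : Q →+ M),
      (∀ s, g (f s) = (s : M)) ∧ IsUnperforated Q ∧ IsCancellative Q := by
  obtain ⟨W⟩ := htame (AddSubmonoid.closure (T : Set M)) ⟨T, rfl⟩
  letI := W.instN
  refine ⟨(kerCon W.g).Quotient, inferInstance, (kerCon W.g).mk'.comp W.f,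
    (kerCon W.g).lift W.g ?_, ?_, quot_facts W.g W.fg W.refinement hsf hcon⟩
  · rintro x y ⟨i, j, hi, hj, h⟩
    have := congrArg W.g h
    simpa [hi, hj] using this
  · intro s
    exact W.factors s

theorem tame_forward {M : Type*} [AddCommMonoid M] (htame : IsTame M)
    (hsf : IsStablyFinite M) (hcon : IsConical M) : IsUnperforated M ∧ IsCancellative M := by
  classical
  constructor
  · rintro m x y hm ⟨z, hz⟩
    obtain ⟨Q, _, f, g, hfg, hu, -⟩ := witness_facts htame hsf hcon {x, y, z}
    let x' : AddSubmonoid.closure (({x, y, z} : Finset M) : Set M) :=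
      ⟨x, AddSubmonoid.subset_closure (by simp)⟩
    let y' : AddSubmonoid.closure (({x, y, z} : Finset M) : Set M) :=
      ⟨y, AddSubmonoid.subset_closure (by simp)⟩
    let z' : AddSubmonoid.closure (({x, y, z} : Finset M) : Set M) :=
      ⟨z, AddSubmonoid.subset_closure (by simp)⟩
    have h : m • x' + z' = m • y' := Subtype.ext hz
    obtain ⟨w, hw⟩ := hu m (f x') (f y') hm ⟨f z', by rw [← map_nsmul, ← map_nsmul, ← map_add, h]⟩
    refine ⟨g w, ?_⟩
    have := congrArg g hw
    rwa [map_add, hfg, hfg] at this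
  · intro x y z hz
    obtain ⟨Q, _, f, g, hfg, -, hc⟩ := witness_facts htame hsf hcon {x, y, z}
    let x' : AddSubmonoid.closure (({x, y, z} : Finset M) : Set M) :=
      ⟨x, AddSubmonoid.subset_closure (by simp)⟩
    let y' : AddSubmonoid.closure (({x, y, z} : Finset M) : Set M) :=
      ⟨y, AddSubmonoid.subset_closure (by simp)⟩
    let z' : AddSubmonoid.closure (({x, y, z} : Finset M) : Set M) :=
      ⟨z, AddSubmonoid.subset_closure (by simp)⟩
    have h : x' + y' = x' + z' := Subtype.ext hz
    have := congrArg g (hc (f x') (f y') (f z') (by rw [← map_add, ← map_add, h]))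
    rwa [hfg, hfg] at this

end partA

section partB

theorem riesz_dec {M : Type*} [AddCommMonoid M] (href : IsRefinementAddMonoid M) (hcon : IsConical M)
    {ι : Type*} [DecidableEq ι] (s : Finset ι) (y : ι → M) :
    ∀ x : M, AlgLE x (∑ j ∈ s, y j) →
      ∃ w v : ι → M, x = ∑ j ∈ s, w j ∧ ∀ j ∈ s, y j = w j + v j := by
  induction s using Finset.induction_on with
  | empty =>
    rintro x ⟨t, ht⟩
    refine ⟨0, 0, ?_, by simp⟩
    simpa using (hcon x t (by simpa using ht)).1
  | insert a s ha ih =>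
    rintro x ⟨t, ht⟩
    rw [Finset.sum_insert ha] at ht
    obtain ⟨z1, z2, z3, z4, h1, h2, h3, h4⟩ := href _ _ _ _ ht
    obtain ⟨w, v, hw, hv⟩ := ih z2 ⟨z4, h4.symm⟩
    refine ⟨Function.update w a z1, Function.update v a z3, ?_, ?_⟩
    · rw [Finset.sum_insert ha, h1, hw]
      simp only [Function.update_self]
      congr 1
      refine Finset.sum_congr rfl fun j hj => ?_
      rw [Function.update_of_ne (by rintro rfl; exact ha hj)]
    · intro j hj
      by_cases h : j = a
      · subst h; simpa using h3
      · simp only [Function.update_of_ne h]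
        exact hv j ((Finset.mem_insert.1 hj).resolve_left h)

/-- simultaneous factorization of `x` annihilating the relation `c`. -/
def Fac {M : Type*} [AddCommMonoid M] {ι : Type} [Fintype ι] (x : ι → M) (c : ι → ℤ) : Prop :=
  ∃ (κ : Type) (_ : Fintype κ) (z : κ → M) (A : ι → κ → ℕ),
    (∀ i, x i = ∑ k, A i k • z k) ∧ ∀ k, ∑ i, c i * (A i k : ℤ) = 0

theorem comp_z {M : Type*} [AddCommMonoid M] {ι κ μ : Type} [Fintype ι] [Fintype κ] [Fintype μ]
    (x : ι → M) (z : κ → M) (y : μ → M) (A : ι → κ → ℕ) (B : κ → μ → ℕ)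
    (h : ∀ i, x i = ∑ k, A i k • z k) (h' : ∀ k, z k = ∑ m, B k m • y m) (i : ι) :
    x i = ∑ m, (∑ k, A i k * B k m) • y m := by
  simp only [h, h', Finset.smul_sum, Finset.sum_smul, mul_smul]
  rw [Finset.sum_comm]

theorem comp_c {ι κ μ : Type} [Fintype ι] [Fintype κ] [Fintype μ]
    (c : ι → ℤ) (A : ι → κ → ℕ) (B : κ → μ → ℕ) (m : μ) :
    ∑ i, c i * ((∑ k, A i k * B k m : ℕ) : ℤ) = ∑ k, (∑ i, c i * (A i k : ℤ)) * (B k m : ℤ) := by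
  push_cast
  simp only [Finset.mul_sum, Finset.sum_mul]
  rw [Finset.sum_comm]
  simp only [mul_assoc]

theorem Fac.comp {M : Type*} [AddCommMonoid M] {ι κ : Type} [Fintype ι] [Fintype κ]
    (x : ι → M) (c : ι → ℤ) (z : κ → M) (A : ι → κ → ℕ)
    (h : ∀ i, x i = ∑ k, A i k • z k)
    (hf : Fac z (fun k => ∑ i, c i * (A i k : ℤ))) : Fac x c := by
  obtain ⟨μ, _, y, B, h1, h2⟩ := hf
  refine ⟨μ, inferInstance, y, fun i m => ∑ k, A i k * B k m, comp_z x z y A B h h1, fun m => ?_⟩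
  rw [comp_c]; exact h2 m

theorem Fac.neg {M : Type*} [AddCommMonoid M] {ι : Type} [Fintype ι]
    {x : ι → M} {c : ι → ℤ} (h : Fac x (fun i => - c i)) : Fac x c := by
  obtain ⟨κ, _, z, A, h1, h2⟩ := h
  refine ⟨κ, inferInstance, z, A, h1, fun k => ?_⟩
  have := h2 k
  simpa [neg_mul, Finset.sum_neg_distrib] using this

theorem rel_comp {M G : Type*} [AddCommMonoid M] [AddCommGroup G] (e : M →+ G)
    {ι κ : Type} [Fintype ι] [Fintype κ]
    (x : ι → M) (c : ι → ℤ) (z : κ → M) (A : ι → κ → ℕ)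
    (h : ∀ i, x i = ∑ k, A i k • z k) :
    ∑ k, (∑ i, c i * (A i k : ℤ)) • e (z k) = ∑ i, c i • e (x i) := by
  simp only [h, map_sum, map_nsmul, Finset.smul_sum, Finset.sum_smul, mul_smul, natCast_zsmul]
  rw [Finset.sum_comm]

/-- the reduction step, at an index with maximal positive coefficient -/
theorem step {M G : Type*} [AddCommMonoid M] [AddCommGroup G] (e : M →+ G)
    (he : Function.Injective e) (href : IsRefinementAddMonoid M) (hcon : IsConical M) (hu : IsUnperforated M)
    {ι : Type} [Fintype ι] [DecidableEq ι] (x : ι → M) (c : ι → ℤ)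
    (hrel : ∑ i, c i • e (x i) = 0) (n : ℕ) (hn : 0 < n) (hc : ∀ i, |c i| ≤ n)
    (i0 : ι) (hi0 : c i0 = n)
    (IH : ∀ (z : ι ⊕ ι → M) (d : ι ⊕ ι → ℤ), (∑ i, d i • e (z i) = 0) →
      (∀ i, |d i| ≤ n) → (∀ i, |d (Sum.inl i)| < n) → (∀ i, i ≠ i0 → d (Sum.inr i) = c i) →
      d (Sum.inr i0) = 0 → Fac z d) : Fac x c := by
  set s : Finset ι := Finset.univ.filter (fun i => c i < 0) with hs
  have hmem : ∀ i, i ∈ s ↔ c i < 0 := by simp [hs]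
  have hi0s : i0 ∉ s := by rw [hmem, hi0]; omega
  have hle : AlgLE (x i0) (∑ j ∈ s, x j) := by
    apply hu n _ _ hn
    refine ⟨∑ j ∈ Finset.univ.erase i0, (if c j < 0 then (n + c j).toNat else (c j).toNat) • x j, ?_⟩
    apply he
    have h1 : ∀ j, (if c j < 0 then (n + c j).toNat else (c j).toNat) • e (x j)
        = c j • e (x j) + (if j ∈ s then (n : ℤ) else 0) • e (x j) := by
      intro j
      rw [← add_smul, ← natCast_zsmul]
      congr 1
      have := abs_le.1 (hc j)
      simp only [hmem]
      split_ifs <;> omega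
    simp only [map_add, map_sum, map_nsmul, h1, Finset.sum_add_distrib]
    have h2 : ∑ j ∈ Finset.univ.erase i0, c j • e (x j) = - ((n : ℤ) • e (x i0)) := by
      rw [← Finset.add_sum_erase _ _ (Finset.mem_univ i0), hi0] at hrel
      exact eq_neg_of_add_eq_zero_right hrel
    have h3 : ∑ j ∈ Finset.univ.erase i0, (if j ∈ s then (n : ℤ) else 0) • e (x j)
        = n • ∑ j ∈ s, e (x j) := by
      have : ∑ j, (if j ∈ s then (n : ℤ) else 0) • e (x j) = n • ∑ j ∈ s, e (x j) := by
        simp only [ite_smul, zero_smul, Finset.sum_ite_mem, Finset.univ_inter, natCast_zsmul,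
          Finset.smul_sum]
      rw [← this, ← Finset.add_sum_erase _ _ (Finset.mem_univ i0), if_neg hi0s, zero_smul, zero_add]
    rw [h2, h3, natCast_zsmul]
    abel
  obtain ⟨w, v, hw, hv⟩ := riesz_dec href hcon s x _ hle
  let z : ι ⊕ ι → M := Sum.elim w (fun i => if i ∈ s then v i else x i)
  let B : ι → ι ⊕ ι → ℕ := fun i => Sum.elim
    (fun j => if j ∈ s then (if i = i0 then 1 else 0) + (if i = j then 1 else 0) else 0)
    (fun j => if i = j then (if j = i0 then 0 else 1) else 0)
  have hB : ∀ i, x i = ∑ k, B i k • z k := by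
    intro i
    simp only [Fintype.sum_sum_type, B, z, Sum.elim_inl, Sum.elim_inr, ite_smul, zero_smul,
      Finset.sum_ite_eq, Finset.mem_univ, if_true, Finset.sum_ite_mem, Finset.univ_inter,
      add_smul, one_smul, Finset.sum_add_distrib]
    by_cases h : i = i0
    · subst h
      simp [hi0s, hw]
    · by_cases h' : i ∈ s
      · simp [h, h', hv i h']
      · simp [h, h']
  refine Fac.comp x c z B hB ?_
  have d1 : ∀ j, ∑ i, c i * (B i (Sum.inl j) : ℤ) = if j ∈ s then n + c j else 0 := by
    intro j
    by_cases h : j ∈ s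
    · simp [B, h, mul_add, Finset.sum_add_distrib, hi0]
    · simp [B, h]
  have d2 : ∀ j, ∑ i, c i * (B i (Sum.inr j) : ℤ) = if j = i0 then 0 else c j := by
    intro j
    by_cases h : j = i0
    · simp [B, h]
    · simp [B, h]
  apply IH
  · rw [rel_comp e x c z B hB, hrel]
  · rintro (j | j)
    · rw [d1]
      have := abs_le.1 (hc j)
      rw [abs_le]
      simp only [hmem]
      split_ifs <;> constructor <;> omega
    · rw [d2]
      split_ifs
      · simp
      · exact hc j
  · intro j
    rw [d1]
    have := abs_le.1 (hc j)
    rw [abs_lt]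
    simp only [hmem]
    split_ifs <;> constructor <;> omega
  · intro i hi
    rw [d2, if_neg hi]
  · rw [d2, if_pos rfl]

theorem fac_main {M G : Type*} [AddCommMonoid M] [AddCommGroup G] (e : M →+ G)
    (he : Function.Injective e) (href : IsRefinementAddMonoid M) (hcon : IsConical M) (hu : IsUnperforated M) (n : ℕ) :
    ∀ (m : ℕ) (ι : Type) [Fintype ι] (x : ι → M) (c : ι → ℤ),
      (∑ i, c i • e (x i) = 0) → (∀ i, |c i| ≤ n) →
      (Finset.univ.filter (fun i => |c i| = n)).card = m → Fac x c := by
  classical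
  induction n with
  | zero =>
    intro m ι _ x c _ hc _
    have h0 : ∀ i, c i = 0 := fun i => abs_nonpos_iff.1 (by simpa using hc i)
    refine ⟨ι, inferInstance, x, fun i j => if i = j then 1 else 0, fun i => ?_, fun k => ?_⟩
    · simp
    · simp [h0]
  | succ n ihn =>
    intro m
    induction m with
    | zero =>
      intro ι _ x c hrel hc hm
      refine ihn _ ι x c hrel (fun i => ?_) rfl
      have h1 : |c i| ≠ (n + 1 : ℕ) := by
        intro h
        have := Finset.card_eq_zero.1 hm
        have h2 : i ∈ Finset.univ.filter (fun i => |c i| = (n + 1 : ℕ)) := by simp [h]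
        rw [this] at h2
        simp at h2
      have := hc i
      push_cast at *
      omega
    | succ m ihm =>
      intro ι _ 
      have pos : ∀ (x : ι → M) (c : ι → ℤ),
          (∑ i, c i • e (x i) = 0) → (∀ i, |c i| ≤ (n + 1 : ℕ)) →
          (Finset.univ.filter (fun i => |c i| = (n + 1 : ℕ))).card = m + 1 →
          (∃ i0, c i0 = (n + 1 : ℕ)) → Fac x c := by
        rintro x c hrel hc hm ⟨i0, hi0⟩
        refine step e he href hcon hu x c hrel (n + 1) (by omega) hc i0 hi0 ?_
        intro z d hrel' hd hl hr hr0
        refine ihm (ι ⊕ ι) z d hrel' hd ?_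
        have : Finset.univ.filter (fun i => |d i| = (n + 1 : ℕ)) =
            ((Finset.univ.filter (fun i => |c i| = (n + 1 : ℕ))).erase i0).map
              Function.Embedding.inr := by
          ext k
          rcases k with k | k
          · simp only [Finset.mem_filter, Finset.mem_univ, true_and, Finset.mem_map,
              Function.Embedding.inr_apply, reduceCtorEq, and_false, exists_false, iff_false]
            exact (hl k).ne
          · simp only [Finset.mem_filter, Finset.mem_univ, true_and, Finset.mem_map,
              Function.Embedding.inr_apply, Sum.inr.injEq, exists_eq_right, Finset.mem_erase]
            by_cases h : k = i0
            · subst h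
              rw [hr0]
              simp
              omega
            · rw [hr k h]; simp [h]
        rw [this, Finset.card_map, Finset.card_erase_of_mem, hm]
        · rfl
        · simp only [Finset.mem_filter, Finset.mem_univ, true_and, hi0]
          exact abs_of_nonneg (by positivity)
      intro x c hrel hc hm
      obtain ⟨i0, hi0⟩ : (Finset.univ.filter (fun i => |c i| = (n + 1 : ℕ))).Nonempty := by
        rw [← Finset.card_pos]; omega
      simp only [Finset.mem_filter, Finset.mem_univ, true_and] at hi0
      rcases abs_choice (c i0) with h | h
      · exact pos x c hrel hc hm ⟨i0, by rw [← h, hi0]⟩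
      · apply Fac.neg
        refine pos x _ ?_ (by simpa using hc) (by simpa using hm) ⟨i0, by rw [← h, hi0]⟩
        simp [hrel]

theorem fac_all {M G : Type*} [AddCommMonoid M] [AddCommGroup G] (e : M →+ G)
    (he : Function.Injective e) (href : IsRefinementAddMonoid M) (hcon : IsConical M) (hu : IsUnperforated M)
    {ι : Type} [Fintype ι] (x : ι → M) (c : ι → ℤ)
    (h : ∑ i, c i • e (x i) = 0) : Fac x c := by
  refine fac_main e he href hcon hu (∑ i, (c i).natAbs) _ ι x c h (fun i => ?_) rfl
  rw [Int.abs_eq_natAbs]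
  exact_mod_cast Finset.single_le_sum (f := fun i => (c i).natAbs) (fun _ _ => Nat.zero_le _)
    (Finset.mem_univ i)

theorem fac_finset {M G : Type*} [AddCommMonoid M] [AddCommGroup G] (e : M →+ G)
    (he : Function.Injective e) (href : IsRefinementAddMonoid M) (hcon : IsConical M) (hu : IsUnperforated M)
    {ι : Type} [Fintype ι] (x : ι → M) (T : Finset (ι → ℤ))
    (h : ∀ c ∈ T, ∑ i, c i • e (x i) = 0) :
    ∃ (κ : Type) (_ : Fintype κ) (z : κ → M) (A : ι → κ → ℕ),
    (∀ i, x i = ∑ k, A i k • z k) ∧ ∀ c ∈ T, ∀ k, ∑ i, c i * (A i k : ℤ) = 0 := by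
  classical
  induction T using Finset.induction_on with
  | empty => exact ⟨ι, inferInstance, x, fun i j => if i = j then 1 else 0, by simp, by simp⟩
  | insert c T hcT ih =>
    obtain ⟨κ, _, z, A, h1, h2⟩ := ih (fun c hc => h c (Finset.mem_insert_of_mem hc))
    obtain ⟨μ, _, y, B, h3, h4⟩ := fac_all e he href hcon hu z (fun k => ∑ i, c i * (A i k : ℤ))
      (by rw [rel_comp e x c z A h1]; exact h c (Finset.mem_insert_self _ _))
    refine ⟨μ, inferInstance, y, fun i m => ∑ k, A i k * B k m, comp_z x z y A B h1 h3, ?_⟩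
    intro c' hc' m
    rw [comp_c]
    rcases Finset.mem_insert.1 hc' with rfl | hc'
    · exact h4 m
    · simp [h2 c' hc']

theorem fac_ker {M G : Type*} [AddCommMonoid M] [AddCommGroup G] (e : M →+ G)
    (he : Function.Injective e) (href : IsRefinementAddMonoid M) (hcon : IsConical M) (hu : IsUnperforated M)
    {ι : Type} [Fintype ι] (x : ι → M) :
    ∃ (κ : Type) (_ : Fintype κ) (z : κ → M) (A : ι → κ → ℕ),
    (∀ i, x i = ∑ k, A i k • z k) ∧ ∀ c : ι → ℤ, ∑ i, c i • e (x i) = 0 →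
      ∀ k, ∑ i, c i * (A i k : ℤ) = 0 := by
  let L : (ι → ℤ) →ₗ[ℤ] G := Fintype.linearCombination ℤ (fun i => e (x i))
  have hL : ∀ c, L c = ∑ i, c i • e (x i) := fun c => rfl
  obtain ⟨T, hT⟩ := IsNoetherian.noetherian (LinearMap.ker L)
  obtain ⟨κ, _, z, A, h1, h2⟩ := fac_finset e he href hcon hu x T (by
    intro c hc
    have : c ∈ LinearMap.ker L := by rw [← hT]; exact Submodule.subset_span hc
    rwa [LinearMap.mem_ker, hL] at this)
  refine ⟨κ, inferInstance, z, A, h1, fun c hc k => ?_⟩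
  have hm : c ∈ Submodule.span ℤ (T : Set (ι → ℤ)) := by rw [hT, LinearMap.mem_ker, hL, hc]
  clear hc
  induction hm using Submodule.span_induction with
  | mem c hc => exact h2 c hc k
  | zero => simp
  | add c d _ _ h h' => simp [add_mul, Finset.sum_add_distrib, h, h']
  | smul a c _ h => simp [mul_assoc, ← Finset.mul_sum, h]

theorem tame_backward {M : Type*} [AddCommMonoid M] (href : IsRefinementAddMonoid M) (hcon : IsConical M)
    (hu : IsUnperforated M) (hc : IsCancellative M) : IsTame M := by
  classical
  rintro S ⟨T, rfl⟩
  letI : AddCancelCommMonoid M := { ‹AddCommMonoid M› with add_left_cancel := fun x y z h => hc x y z h }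
  let e : M →+ Algebra.GrothendieckAddGroup M := Algebra.GrothendieckAddGroup.of
  have he : Function.Injective e := Algebra.GrothendieckAddGroup.of_injective
  let x : Fin T.card → M := fun i => (T.equivFin.symm i : M)
  obtain ⟨κ, _, z, A, h1, h2⟩ := fac_ker e he href hcon hu x
  have hwd : ∀ a b : Fin T.card → ℕ, ∑ i, a i • x i = ∑ i, b i • x i →
      ∀ k, ∑ i, a i * A i k = ∑ i, b i * A i k := by
    intro a b hab k
    have := h2 (fun i => (a i : ℤ) - b i) (by
      have := congrArg e hab
      simp only [map_sum, map_nsmul] at this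
      simp only [sub_smul, Finset.sum_sub_distrib, natCast_zsmul, this, sub_self]) k
    simp only [sub_mul, Finset.sum_sub_distrib, sub_eq_zero] at this
    exact_mod_cast this
  have hex : ∀ s : AddSubmonoid.closure (T : Set M), ∃ a : Fin T.card → ℕ,
      (s : M) = ∑ i, a i • x i := by
    rintro ⟨s, hs⟩
    induction hs using AddSubmonoid.closure_induction with
    | mem s hs =>
      refine ⟨fun i => if i = T.equivFin ⟨s, hs⟩ then 1 else 0, ?_⟩
      simp [x]
    | zero => exact ⟨0, by simp⟩
    | add s t _ _ h h' =>
      obtain ⟨a, ha⟩ := h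
      obtain ⟨b, hb⟩ := h'
      refine ⟨a + b, ?_⟩
      simp only [] at ha hb
      simp [ha, hb, add_smul, Finset.sum_add_distrib]
  choose a ha using hex
  refine ⟨{ N := κ → ℕ, fg := ?_, refinement := ?_, f := ?_, g := ?_, factors := ?_ }⟩
  · have h : ((⊤ : AddSubmonoid (κ → ℕ))).FG := by
      rw [← AddSubmonoid.pi_top Set.univ]
      exact AddSubmonoid.FG.pi fun _ => AddMonoid.FG.fg_top
    exact ⟨h⟩
  · intro x1 x2 y1 y2 h
    have h' : ∀ k, x1 k + x2 k = y1 k + y2 k := fun k => congrFun h k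
    refine ⟨fun k => min (x1 k) (y1 k), fun k => x1 k - y1 k, fun k => y1 k - x1 k,
      fun k => x2 k - (y1 k - x1 k), ?_, ?_, ?_, ?_⟩ <;> funext k <;>
      have := h' k <;> simp only [Pi.add_apply] <;> omega
  · exact
    { toFun := fun s k => ∑ i, a s i * A i k
      map_zero' := by
        funext k
        rw [hwd (a 0) 0 (by rw [← ha]; simp) k]
        simp
      map_add' := by
        intro s t
        funext k
        rw [hwd (a (s + t)) (a s + a t) (by
          rw [← ha]
          simp only [Pi.add_apply, add_smul, Finset.sum_add_distrib, ← ha]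
          rfl) k]
        simp [add_mul, Finset.sum_add_distrib] }
  · exact
    { toFun := fun n => ∑ k, n k • z k
      map_zero' := by simp
      map_add' := by intro s t; simp [add_smul, Finset.sum_add_distrib] }
  · intro s
    conv_rhs => rw [ha s]
    simp only [AddMonoidHom.coe_mk, ZeroHom.coe_mk, h1, Finset.sum_smul, Finset.smul_sum, mul_smul]
    rw [Finset.sum_comm]

end partB

/-- A stably finite conical refinement monoid is tame if and only if it is unperforated
and cancellative. -/
theorem tame_iff_unperforated_cancellative
    (M : Type*) [AddCommMonoid M] (href : IsRefinementAddMonoid M)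
    (hsf : IsStablyFinite M) (hcon : IsConical M) :
    IsTame M ↔ (IsUnperforated M ∧ IsCancellative M) := by
  exact ⟨fun h => tame_forward h hsf hcon, fun h => tame_backward href hcon h.1 h.2⟩
end

section
/- Let M be a tame refinement monoid, and let ∼ be the congruence on M given by x ∼ y if and only if there exists z ∈ M with x + z = y + z. Then the maximal cancellative quotient M/∼ satisfies the Riesz decomposition property: if [a] ≤ [b1] + [b2] in M/∼, then there exist a1, a2 ∈ M with [a] = [a1] + [a2], [a1] ≤ [b1], and [a2] ≤ [b2]. -/
/-- The congruence `x ∼ y` iff `x + z = y + z` for some `z`; the quotient is the maximal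
cancellative quotient of `M`. -/
def cancelCon (M : Type*) [AddCommMonoid M] : AddCon M where
  r x y := ∃ z : M, x + z = y + z
  iseqv := by
    constructor
    · exact fun x => ⟨0, rfl⟩
    · rintro x y ⟨z, h⟩
      exact ⟨z, h.symm⟩
    · rintro x y w ⟨z1, h1⟩ ⟨z2, h2⟩
      refine ⟨z1 + z2, ?_⟩
      calc x + (z1 + z2) = (x + z1) + z2 := by rw [add_assoc]
        _ = (y + z1) + z2 := by rw [h1]
        _ = (y + z2) + z1 := by abel
        _ = (w + z2) + z1 := by rw [h2]
        _ = w + (z1 + z2) := by abel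
  add' := by
    rintro w x y z ⟨u, h1⟩ ⟨v, h2⟩
    refine ⟨u + v, ?_⟩
    calc w + y + (u + v) = (w + u) + (y + v) := by abel
      _ = (x + u) + (z + v) := by rw [h1, h2]
      _ = x + z + (u + v) := by abel

/-- A finitely generated stably finite conical refinement monoid is cancellative. -/
theorem cancel_of_fg_stably_finite (Q : Type*) [AddCommMonoid Q] (hfg : AddMonoid.FG Q)
    (href : IsRefinementAddMonoid Q) (hsf : ∀ x y z : Q, x + y + z = z → x = 0)
    (a b c : Q) (h : a + c = b + c) : a = b := by
  classical
  obtain ⟨S0, hS0⟩ := hfg.fg_top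
  have hex : ∃ n : ℕ, ∃ S : Finset Q, AddSubmonoid.closure (S : Set Q) = ⊤ ∧ S.card = n :=
    ⟨_, S0, hS0, rfl⟩
  obtain ⟨S, hS, hcard⟩ := Nat.find_spec hex
  have hmin : ∀ T : Finset Q, AddSubmonoid.closure (T : Set Q) = ⊤ → S.card ≤ T.card := by
    intro T hT
    rw [hcard]
    exact Nat.find_min' hex ⟨T, hT, rfl⟩
  have hirr : ∀ p ∈ S, ∀ x y : Q, p = x + y → x = 0 ∨ y = 0 := by
    intro p hp
    have hdec : ∀ x : Q, (∃ x', x = p + x') ∨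
        x ∈ AddSubmonoid.closure ((S.erase p : Finset Q) : Set Q) := by
      intro x
      have hx : x ∈ AddSubmonoid.closure (S : Set Q) := by rw [hS]; trivial
      induction hx using AddSubmonoid.closure_induction with
      | mem x hx =>
        by_cases hxp : x = p
        · exact Or.inl ⟨0, by simp [hxp]⟩
        · exact Or.inr (AddSubmonoid.subset_closure (by simpa [hxp] using hx))
      | zero => exact Or.inr (zero_mem _)
      | add x y _ _ ihx ihy =>
        rcases ihx with ⟨x', rfl⟩ | hx
        · exact Or.inl ⟨x' + y, by abel⟩
        · rcases ihy with ⟨y', rfl⟩ | hy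
          · exact Or.inl ⟨x + y', by abel⟩
          · exact Or.inr (add_mem hx hy)
    intro x y hxy
    rcases hdec x with ⟨x', hx'⟩ | hx
    · right
      apply hsf y x' p
      conv_rhs => rw [hxy, hx']
      abel
    · rcases hdec y with ⟨y', hy'⟩ | hy
      · left
        apply hsf x y' p
        conv_rhs => rw [hxy, hy']
        abel
      · exfalso
        have hpm : p ∈ AddSubmonoid.closure ((S.erase p : Finset Q) : Set Q) := by
          have := add_mem hx hy
          rwa [← hxy] at this
        have htop : AddSubmonoid.closure ((S.erase p : Finset Q) : Set Q) = ⊤ := by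
          rw [eq_top_iff, ← hS, AddSubmonoid.closure_le]
          intro q hq
          by_cases hqp : q = p
          · rw [hqp]; exact hpm
          · exact AddSubmonoid.subset_closure (by simpa [hqp] using hq)
        have h1 := hmin _ htop
        have h2 := Finset.card_erase_lt_of_mem hp
        omega
  have hc : c ∈ AddSubmonoid.closure (S : Set Q) := by rw [hS]; trivial
  induction hc using AddSubmonoid.closure_induction generalizing a b with
  | mem p hp =>
    obtain ⟨z11, z12, z21, z22, h1, h2, h3, h4⟩ := href _ _ _ _ h
    rcases hirr p hp _ _ h2 with h5 | h5
    · rcases hirr p hp _ _ h4 with h6 | h6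
      · rw [h1, h3, h5, h6]
      · rw [h6, add_zero] at h2 h4
        rw [h1, h3, ← h2, ← h4]
    · rw [h5, add_zero] at h2 h4
      rw [h1, h3, ← h2, ← h4]
  | zero => simpa using h
  | add x y _ _ ihx ihy =>
    apply ihx
    apply ihy
    rw [add_assoc, add_assoc]
    exact h

/-- Elements which become invertible in the maximal cancellative quotient. -/
def stabU (N : Type*) [AddCommMonoid N] : AddSubmonoid N where
  carrier := {x | ∃ t z : N, x + t + z = z}
  zero_mem' := ⟨0, 0, by simp⟩
  add_mem' := by
    rintro x y ⟨t, z, h⟩ ⟨t', z', h'⟩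
    refine ⟨t + t', z + z', ?_⟩
    calc x + y + (t + t') + (z + z') = (x + t + z) + (y + t' + z') := by abel
      _ = z + z' := by rw [h, h']

/-- The congruence attached to the order ideal `stabU`. -/
def stabCon (N : Type*) [AddCommMonoid N] : AddCon N where
  r x y := ∃ u ∈ stabU N, ∃ v ∈ stabU N, x + u = y + v
  iseqv := by
    constructor
    · exact fun x => ⟨0, zero_mem _, 0, zero_mem _, rfl⟩
    · rintro x y ⟨u, hu, v, hv, h⟩
      exact ⟨v, hv, u, hu, h.symm⟩
    · rintro x y w ⟨u, hu, v, hv, h⟩ ⟨u', hu', v', hv', h'⟩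
      refine ⟨u + u', add_mem hu hu', v' + v, add_mem hv' hv, ?_⟩
      calc x + (u + u') = (x + u) + u' := by abel
        _ = (y + u') + v := by rw [h]; abel
        _ = w + (v' + v) := by rw [h']; abel
  add' := by
    rintro w x y z ⟨u, hu, v, hv, h⟩ ⟨u', hu', v', hv', h'⟩
    refine ⟨u + u', add_mem hu hu', v + v', add_mem hv hv', ?_⟩
    calc w + y + (u + u') = (w + u) + (y + u') := by abel
      _ = (x + v) + (z + v') := by rw [h, h']
      _ = x + z + (v + v') := by abel

theorem stabCon_eq {N : Type*} [AddCommMonoid N] (x y : N) :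
    (stabCon N).mk' x = (stabCon N).mk' y ↔ ∃ u ∈ stabU N, ∃ v ∈ stabU N, x + u = y + v :=
  (stabCon N).eq

theorem stabCon_zero {N : Type*} [AddCommMonoid N] {x : N} (hx : x ∈ stabU N) :
    (stabCon N).mk' x = 0 := by
  rw [← map_zero (stabCon N).mk', stabCon_eq]
  exact ⟨0, zero_mem _, x, hx, by abel⟩

theorem fg_key (N : Type*) [AddCommMonoid N] (hfg : AddMonoid.FG N)
    (href : IsRefinementAddMonoid N) (a b z : N) (h : a + z = b + z) :
    ∃ u ∈ stabU N, ∃ v ∈ stabU N, a + u = b + v := by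
  have hsurj : Function.Surjective (stabCon N).mk' := AddCon.mk'_surjective
  rw [← stabCon_eq]
  apply cancel_of_fg_stably_finite (stabCon N).Quotient ?_ ?_ ?_ _ _ ((stabCon N).mk' z)
  · rw [← map_add, ← map_add, h]
  · haveI := hfg
    exact AddMonoid.fg_of_surjective _ hsurj
  · intro x1 x2 y1 y2 hxy
    obtain ⟨x1, rfl⟩ := hsurj x1
    obtain ⟨x2, rfl⟩ := hsurj x2
    obtain ⟨y1, rfl⟩ := hsurj y1
    obtain ⟨y2, rfl⟩ := hsurj y2
    rw [← map_add, ← map_add, stabCon_eq] at hxy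
    obtain ⟨u, hu, v, hv, hxy⟩ := hxy
    rw [add_assoc, add_assoc] at hxy
    obtain ⟨z11, z12, z21, z22, h1, h2, h3, h4⟩ := href _ _ _ _ hxy
    refine ⟨(stabCon N).mk' z11, (stabCon N).mk' z12, (stabCon N).mk' z21,
      (stabCon N).mk' z22, ?_, ?_, ?_, ?_⟩
    · rw [h1, map_add]
    · rw [← map_add, ← h2, map_add, stabCon_zero hu, add_zero]
    · rw [h3, map_add]
    · rw [← map_add, ← h4, map_add, stabCon_zero hv, add_zero]
  · intro x y w hx
    obtain ⟨x, rfl⟩ := hsurj x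
    obtain ⟨y, rfl⟩ := hsurj y
    obtain ⟨w, rfl⟩ := hsurj w
    rw [← map_add, ← map_add, stabCon_eq] at hx
    obtain ⟨u, hu, v, ⟨t, s, hv⟩, hx⟩ := hx
    apply stabCon_zero
    refine ⟨y + u + t, w + s, ?_⟩
    calc x + (y + u + t) + (w + s) = (x + y + w + u) + (t + s) := by abel
      _ = w + (v + t + s) := by rw [hx]; abel
      _ = w + s := by rw [hv]

theorem fg_decomp (N : Type*) [AddCommMonoid N] (hfg : AddMonoid.FG N)
    (href : IsRefinementAddMonoid N) (a c b1 b2 z : N) (h : a + c + z = b1 + b2 + z) :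
    ∃ x1 x2 u w1 w2 t s : N, a = x1 + x2 + u ∧ x1 + w1 = b1 ∧ x2 + w2 = b2 ∧
      u + t + s = s := by
  obtain ⟨u, hu, v, ⟨t, s, hv⟩, h⟩ := fg_key N hfg href _ _ _ h
  rw [add_assoc, add_assoc] at h
  obtain ⟨z11, z12, z21, z22, h1, h2, h3, h4⟩ := href _ _ _ _ h
  obtain ⟨y11, y12, y21, y22, k1, k2, k3, k4⟩ := href _ _ _ _ h4
  refine ⟨z11, y11, y21, z21, y12, y22 + t, s, ?_, h3.symm, k1.symm, ?_⟩
  · rw [h1, k3]; abel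
  · rw [k2] at hv
    rw [← add_assoc y21]
    exact hv

theorem maximal_cancellative_quotient_rieszDecomposition
    (M : Type*) [AddCommMonoid M] (href : IsRefinementAddMonoid M) (htame : IsTame M)
    (a b1 b2 : M)
    (h : AlgLE ((cancelCon M).mk' a) ((cancelCon M).mk' b1 + (cancelCon M).mk' b2)) :
    ∃ a1 a2 : M,
      (cancelCon M).mk' a = (cancelCon M).mk' a1 + (cancelCon M).mk' a2 ∧
      AlgLE ((cancelCon M).mk' a1) ((cancelCon M).mk' b1) ∧
      AlgLE ((cancelCon M).mk' a2) ((cancelCon M).mk' b2) := by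
  classical
  have heq : ∀ x y : M, (cancelCon M).mk' x = (cancelCon M).mk' y ↔ ∃ z, x + z = y + z :=
    fun x y => (cancelCon M).eq
  obtain ⟨c, hc⟩ := h
  obtain ⟨c, rfl⟩ := AddCon.mk'_surjective c
  rw [← map_add, ← map_add, heq] at hc
  obtain ⟨z, hz⟩ := hc
  let T : Finset M := {a, c, b1, b2, z}
  let S := AddSubmonoid.closure (T : Set M)
  have hT : ∀ x ∈ T, x ∈ S := fun x hx => AddSubmonoid.subset_closure hx
  obtain ⟨W⟩ := htame S ⟨T, rfl⟩
  letI := W.instN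
  let a' : S := ⟨a, hT a (by simp [T])⟩
  let c' : S := ⟨c, hT c (by simp [T])⟩
  let b1' : S := ⟨b1, hT b1 (by simp [T])⟩
  let b2' : S := ⟨b2, hT b2 (by simp [T])⟩
  let z' : S := ⟨z, hT z (by simp [T])⟩
  have hz' : a' + c' + z' = b1' + b2' + z' := Subtype.ext hz
  have hN := congrArg W.f hz'
  simp only [map_add] at hN
  obtain ⟨x1, x2, u, w1, w2, t, s, e1, e2, e3, e4⟩ :=
    fg_decomp W.N W.fg W.refinement _ _ _ _ _ hN
  have ha : a = W.g x1 + W.g x2 + W.g u := by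
    rw [← map_add, ← map_add, ← e1]; exact (W.factors a').symm
  have hb1 : W.g x1 + W.g w1 = b1 := by
    rw [← map_add, e2]; exact W.factors b1'
  have hb2 : W.g x2 + W.g w2 = b2 := by
    rw [← map_add, e3]; exact W.factors b2'
  have hu : W.g u + W.g t + W.g s = W.g s := by
    rw [← map_add, ← map_add, e4]
  refine ⟨W.g x1 + W.g u, W.g x2, ?_, ⟨(cancelCon M).mk' (W.g w1 + W.g t), ?_⟩,
    ⟨(cancelCon M).mk' (W.g w2), ?_⟩⟩
  · rw [← map_add, ha]
    congr 1
    abel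
  · rw [← map_add, heq]
    refine ⟨W.g s, ?_⟩
    calc W.g x1 + W.g u + (W.g w1 + W.g t) + W.g s
        = (W.g x1 + W.g w1) + (W.g u + W.g t + W.g s) := by abel
      _ = b1 + W.g s := by rw [hb1, hu]
  · rw [← map_add, hb2]
end
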